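/- Fix s ∈ (0,∞), t > 0, and an integer d ≥ 3. There exists a constant C(d,s,t) > 1 such that for every admissible N, every E ∈ ℝ and every η ≥ (log N)^{−1}, with z = E + iη, one has P( | (1/N)·∑_{j=1}^N (Im G_N(z)_{jj})^s − E[(Im G_N(z)_{11})^s] | ≤ η ) ≥ 1 − C·N^{−100}. -/

import Mathlib

open MeasureTheory ProbabilityTheory Matrix Filter
open scoped ENNReal NNReal Classical Real

noncomputable section

/-- `a` is the Boolean adjacency matrix of a simple `d`-regular graph on `Fin N`:
symmetric, zero diagonal, every row sum equal to `d`. -/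
def IsRegAdj (d N : ℕ) (a : Fin N → Fin N → Bool) : Prop :=
  (∀ i j, a i j = a j i) ∧ (∀ i, a i i = false) ∧
    (∀ i, (Finset.univ.filter (fun j => a i j = true)).card = d)

/-- The tight-binding Hamiltonian `W_N = -t A_N + diag(v)`. -/
def Wmat (t : ℝ) {N : ℕ} (a : Fin N → Fin N → Bool) (v : Fin N → ℝ) :
    Matrix (Fin N) (Fin N) ℝ :=
  fun i j => (if a i j then -t else 0) + (if i = j then v i else 0)

/-- The resMat `G(z) = (W - z)⁻¹` as a complex matrix. -/
def resMat {N : ℕ} (z : ℂ) (W : Matrix (Fin N) (Fin N) ℝ) :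
    Matrix (Fin N) (Fin N) ℂ :=
  (W.map (fun x => (x : ℂ)) - z • 1)⁻¹

/-- The law of `(A_N, (g_1,…,g_N))`: a uniformly random simple `d`-regular graph on `N`
vertices together with independent i.i.d. standard Gaussian potentials. -/
def graphMeasure (d N : ℕ) : Measure ((Fin N → Fin N → Bool) × (Fin N → ℝ)) :=
  (uniformOn {a | IsRegAdj d N a}).prod (Measure.pi fun _ => gaussianReal 0 1)

/-- `Im G_N(z)_{jj}` for the sample `ω = (A_N, v)`. -/
def imG (t : ℝ) (z : ℂ) {N : ℕ} (ω : (Fin N → Fin N → Bool) × (Fin N → ℝ))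
    (j : Fin N) : ℝ :=
  (resMat z (Wmat t ω.1 ω.2) j j).im


/-! ### Part 1: deterministic resolvent estimates -/

/-- The Euclidean norm of a complex vector. -/
def nrm2 {N : ℕ} (w : Fin N → ℂ) : ℝ := ‖(WithLp.toLp 2 w : EuclideanSpace ℂ (Fin N))‖

lemma nrm2_nonneg {N : ℕ} (w : Fin N → ℂ) : 0 ≤ nrm2 w := norm_nonneg _

lemma nrm2_sq {N : ℕ} (w : Fin N → ℂ) : nrm2 w ^ 2 = ∑ i, ‖w i‖ ^ 2 := by
  rw [nrm2, EuclideanSpace.norm_sq_eq]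

lemma nrm2_eq_zero {N : ℕ} {w : Fin N → ℂ} (h : nrm2 w = 0) : w = 0 := by
  rw [nrm2, norm_eq_zero] at h
  simpa using h

lemma nrm2_sub_le {N : ℕ} (w v : Fin N → ℂ) : nrm2 (w - v) ≤ nrm2 w + nrm2 v := by
  unfold nrm2
  rw [WithLp.toLp_sub]
  exact norm_sub_le _ _

lemma nrm2_smul {N : ℕ} (c : ℂ) (w : Fin N → ℂ) : nrm2 (c • w) = ‖c‖ * nrm2 w := by
  unfold nrm2
  rw [WithLp.toLp_smul, norm_smul]

lemma nrm2_star {N : ℕ} (w : Fin N → ℂ) : nrm2 (star w) = nrm2 w := by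
  have : nrm2 (star w) ^ 2 = nrm2 w ^ 2 := by
    rw [nrm2_sq, nrm2_sq]; simp
  exact (pow_left_inj₀ (nrm2_nonneg _) (nrm2_nonneg _) two_ne_zero).1 this

lemma sum_norm_mul_le {N : ℕ} (w v : Fin N → ℂ) :
    ∑ i, ‖w i‖ * ‖v i‖ ≤ nrm2 w * nrm2 v := by
  have h := Finset.sum_mul_sq_le_sq_mul_sq Finset.univ (fun i => ‖w i‖) (fun i => ‖v i‖)
  rw [← nrm2_sq, ← nrm2_sq, ← mul_pow] at h
  exact (pow_le_pow_iff_left₀ (by positivity)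
    (mul_nonneg (nrm2_nonneg _) (nrm2_nonneg _)) two_ne_zero).1 h

lemma norm_dot_le {N : ℕ} (w v : Fin N → ℂ) : ‖w ⬝ᵥ v‖ ≤ nrm2 w * nrm2 v := by
  refine le_trans (norm_sum_le _ _) ?_
  simp only [norm_mul]
  exact sum_norm_mul_le w v

lemma star_dot_self {N : ℕ} (w : Fin N → ℂ) : star w ⬝ᵥ w = ((nrm2 w ^ 2 : ℝ) : ℂ) := by
  rw [nrm2_sq]
  simp only [dotProduct, Pi.star_apply, Complex.ofReal_sum]
  refine Finset.sum_congr rfl fun i _ => ?_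
  rw [RCLike.star_def, Complex.conj_mul']
  simp

lemma nrm2_single {N : ℕ} (i : Fin N) : nrm2 (Pi.single i (1 : ℂ)) = 1 := by
  have h : nrm2 (Pi.single i (1 : ℂ)) ^ 2 = 1 := by
    rw [nrm2_sq, Finset.sum_eq_single i]
    · simp
    · intro b _ hb; simp [Pi.single_eq_of_ne hb]
    · simp
  have h0 := nrm2_nonneg (Pi.single i (1 : ℂ))
  nlinarith

/-- The matrix `W - z`. -/
def shiftM {N : ℕ} (z : ℂ) (W : Matrix (Fin N) (Fin N) ℝ) : Matrix (Fin N) (Fin N) ℂ :=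
  W.map (fun x => (x : ℂ)) - z • 1

lemma resMat_eq {N : ℕ} (z : ℂ) (W : Matrix (Fin N) (Fin N) ℝ) :
    resMat z W = (shiftM z W)⁻¹ := rfl

lemma im_quad {N : ℕ} {W : Matrix (Fin N) (Fin N) ℝ} (hW : W.IsSymm) (z : ℂ) (w : Fin N → ℂ) :
    (star w ⬝ᵥ (shiftM z W *ᵥ w)).im = - z.im * nrm2 w ^ 2 := by
  have h1 : (star w ⬝ᵥ (W.map (fun x => (x : ℂ)) *ᵥ w)).im = 0 := by
    have hH : (W.map (fun x => (x : ℂ))).IsHermitian := by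
      ext i j
      simp [conjTranspose_apply, hW.apply i j]
    have := hH.im_star_dotProduct_mulVec_self w
    simpa using this
  rw [shiftM, sub_mulVec, dotProduct_sub, smul_mulVec, one_mulVec, dotProduct_smul,
    star_dot_self, Complex.sub_im, h1, smul_eq_mul, Complex.mul_im,
    Complex.ofReal_re, Complex.ofReal_im]
  ring

lemma nrm2_shift_ge {N : ℕ} {W : Matrix (Fin N) (Fin N) ℝ} (hW : W.IsSymm) {z : ℂ}
    (hz : 0 < z.im) (w : Fin N → ℂ) : z.im * nrm2 w ≤ nrm2 (shiftM z W *ᵥ w) := by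
  have h1 := im_quad hW z w
  have h2 : z.im * nrm2 w ^ 2 ≤ nrm2 w * nrm2 (shiftM z W *ᵥ w) := by
    have h3 := norm_dot_le (star w) (shiftM z W *ᵥ w)
    rw [nrm2_star] at h3
    have h4 := Complex.abs_im_le_norm (star w ⬝ᵥ (shiftM z W *ᵥ w))
    rw [h1] at h4
    have h5 := neg_abs_le (- z.im * nrm2 w ^ 2)
    linarith
  rcases (nrm2_nonneg w).eq_or_lt with h | h
  · rw [← h, mul_zero]; exact nrm2_nonneg _
  · have : nrm2 w * (z.im * nrm2 w) ≤ nrm2 w * nrm2 (shiftM z W *ᵥ w) := by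
      calc _ = z.im * nrm2 w ^ 2 := by ring
        _ ≤ _ := h2
    exact le_of_mul_le_mul_left this h

lemma shift_isUnit {N : ℕ} {W : Matrix (Fin N) (Fin N) ℝ} (hW : W.IsSymm) {z : ℂ}
    (hz : 0 < z.im) : IsUnit (shiftM z W) := by
  rw [← Matrix.mulVec_injective_iff_isUnit]
  intro w v h
  have h1 : shiftM z W *ᵥ (w - v) = 0 := by
    rw [mulVec_sub]; exact sub_eq_zero.2 h
  have h2 := nrm2_shift_ge hW hz (w - v)
  rw [h1] at h2
  have h3 : nrm2 (0 : Fin N → ℂ) = 0 := by simp [nrm2]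
  rw [h3] at h2
  have h4 : nrm2 (w - v) = 0 := by
    have := nrm2_nonneg (w - v)
    nlinarith
  exact sub_eq_zero.1 (nrm2_eq_zero h4)

lemma shift_mul_res {N : ℕ} {W : Matrix (Fin N) (Fin N) ℝ} (hW : W.IsSymm) {z : ℂ}
    (hz : 0 < z.im) : shiftM z W * resMat z W = 1 := by
  rw [resMat_eq]
  exact Matrix.mul_nonsing_inv _ ((Matrix.isUnit_iff_isUnit_det _).1 (shift_isUnit hW hz))

lemma res_mul_shift {N : ℕ} {W : Matrix (Fin N) (Fin N) ℝ} (hW : W.IsSymm) {z : ℂ}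
    (hz : 0 < z.im) : resMat z W * shiftM z W = 1 := by
  rw [resMat_eq]
  exact Matrix.nonsing_inv_mul _ ((Matrix.isUnit_iff_isUnit_det _).1 (shift_isUnit hW hz))

lemma nrm2_res_le {N : ℕ} {W : Matrix (Fin N) (Fin N) ℝ} (hW : W.IsSymm) {z : ℂ}
    (hz : 0 < z.im) (w : Fin N → ℂ) : nrm2 (resMat z W *ᵥ w) ≤ nrm2 w / z.im := by
  have h := nrm2_shift_ge hW hz (resMat z W *ᵥ w)
  rw [mulVec_mulVec, shift_mul_res hW hz, one_mulVec] at h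
  rw [le_div_iff₀ hz]
  linarith

lemma nrm2_col_le {N : ℕ} {W : Matrix (Fin N) (Fin N) ℝ} (hW : W.IsSymm) {z : ℂ}
    (hz : 0 < z.im) (k : Fin N) : nrm2 (fun j => resMat z W j k) ≤ 1 / z.im := by
  have h := nrm2_res_le hW hz (Pi.single k (1 : ℂ))
  rw [nrm2_single, mulVec_single_one] at h
  exact h

lemma res_symm {N : ℕ} {W : Matrix (Fin N) (Fin N) ℝ} (hW : W.IsSymm) (z : ℂ) (i j : Fin N) :
    resMat z W i j = resMat z W j i := by
  have h : (shiftM z W)ᵀ = shiftM z W := by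
    ext a b
    simp [shiftM, hW.apply a b, Matrix.one_apply, eq_comm]
  have h2 : (resMat z W)ᵀ = resMat z W := by
    rw [resMat_eq, transpose_nonsing_inv, h]
  conv_lhs => rw [← h2]
  rfl

lemma nrm2_row_le {N : ℕ} {W : Matrix (Fin N) (Fin N) ℝ} (hW : W.IsSymm) {z : ℂ}
    (hz : 0 < z.im) (k : Fin N) : nrm2 (fun j => resMat z W k j) ≤ 1 / z.im := by
  have := nrm2_col_le hW hz k
  simpa only [res_symm hW z _ k] using this

lemma im_res_eq {N : ℕ} {W : Matrix (Fin N) (Fin N) ℝ} (hW : W.IsSymm) {z : ℂ}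
    (hz : 0 < z.im) (k : Fin N) :
    (resMat z W k k).im = z.im * nrm2 (fun j => resMat z W j k) ^ 2 := by
  have h := im_quad hW z (resMat z W *ᵥ Pi.single k (1 : ℂ))
  rw [mulVec_mulVec, shift_mul_res hW hz, one_mulVec, mulVec_single_one, dotProduct_single] at h
  simp only [Pi.star_apply, mul_one, col_apply, RCLike.star_def, Complex.conj_im] at h
  have h2 : nrm2 ((resMat z W).col k) = nrm2 (fun j => resMat z W j k) := rfl
  rw [h2] at h
  linarith

lemma im_res_nonneg {N : ℕ} {W : Matrix (Fin N) (Fin N) ℝ} (hW : W.IsSymm) {z : ℂ}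
    (hz : 0 < z.im) (k : Fin N) : 0 ≤ (resMat z W k k).im := by
  rw [im_res_eq hW hz]; positivity

lemma im_res_le {N : ℕ} {W : Matrix (Fin N) (Fin N) ℝ} (hW : W.IsSymm) {z : ℂ}
    (hz : 0 < z.im) (k : Fin N) : (resMat z W k k).im ≤ 1 / z.im := by
  rw [im_res_eq hW hz]
  have h1 := nrm2_col_le hW hz k
  have h0 := nrm2_nonneg (fun j => resMat z W j k)
  calc _ ≤ z.im * (1 / z.im) ^ 2 := by gcongr
    _ = _ := by field_simp

lemma res_sub {N : ℕ} {W W' : Matrix (Fin N) (Fin N) ℝ} (hW : W.IsSymm) (hW' : W'.IsSymm) {z : ℂ}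
    (hz : 0 < z.im) : resMat z W - resMat z W' =
      resMat z W * ((W' - W).map (fun x => (x : ℂ))) * resMat z W' := by
  have h : (W' - W).map (fun x => (x : ℂ)) = shiftM z W' - shiftM z W := by
    ext i j; simp [shiftM]
  rw [h, mul_sub, sub_mul, res_mul_shift hW hz, one_mul, mul_assoc, shift_mul_res hW' hz, mul_one]

/-- perturbing finitely many entries -/
lemma res_diff_entries {N : ℕ} {W W' : Matrix (Fin N) (Fin N) ℝ} (hW : W.IsSymm)
    (hW' : W'.IsSymm) {z : ℂ} (hz : 0 < z.im) (S : Finset (Fin N × Fin N)) (t : ℝ)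
    (hS : ∀ i j, (i, j) ∉ S → W' i j = W i j) (hb : ∀ i j, |W' i j - W i j| ≤ t) :
    ∑ j, |(resMat z W j j).im - (resMat z W' j j).im| ≤ S.card * (t / z.im ^ 2) := by
  have h1 : ∀ j, resMat z W j j - resMat z W' j j =
      ∑ p ∈ S, resMat z W j p.1 * ((W' p.1 p.2 - W p.1 p.2 : ℝ) : ℂ) * resMat z W' p.2 j := by
    intro j
    have h2 := congrFun (congrFun (res_sub hW hW' hz) j) j
    rw [Matrix.sub_apply] at h2
    rw [h2, Matrix.mul_apply]
    simp only [Matrix.mul_apply, Finset.sum_mul]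
    rw [Finset.sum_comm, ← Finset.sum_product', Finset.univ_product_univ]
    symm
    refine Finset.sum_subset (Finset.subset_univ _) ?_ |>.trans ?_
    · rintro ⟨a, b⟩ _ hab
      simp [hS a b hab]
    · refine Finset.sum_congr rfl fun p _ => ?_
      simp
  calc ∑ j, |(resMat z W j j).im - (resMat z W' j j).im|
      ≤ ∑ j, ∑ p ∈ S, t * (‖resMat z W j p.1‖ * ‖resMat z W' p.2 j‖) := by
        refine Finset.sum_le_sum fun j _ => ?_
        rw [← Complex.sub_im]
        refine (Complex.abs_im_le_norm _).trans ?_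
        rw [h1]
        refine (norm_sum_le _ _).trans ?_
        refine Finset.sum_le_sum fun p _ => ?_
        rw [norm_mul, norm_mul, Complex.norm_real, Real.norm_eq_abs]
        have := hb p.1 p.2
        calc _ = |W' p.1 p.2 - W p.1 p.2| * (‖resMat z W j p.1‖ * ‖resMat z W' p.2 j‖) := by ring
          _ ≤ _ := by gcongr
    _ = ∑ p ∈ S, t * ∑ j, (‖resMat z W j p.1‖ * ‖resMat z W' p.2 j‖) := by
        rw [Finset.sum_comm]; simp only [Finset.mul_sum]
    _ ≤ ∑ p ∈ S, t / z.im ^ 2 := by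
        refine Finset.sum_le_sum fun p _ => ?_
        have ht : 0 ≤ t := (abs_nonneg _).trans (hb p.1 p.2)
        have h3 := sum_norm_mul_le (fun j => resMat z W j p.1) (fun j => resMat z W' p.2 j)
        have h4 := nrm2_col_le hW hz p.1
        have h5 := nrm2_row_le hW' hz p.2
        have h6 : ∑ j, (‖resMat z W j p.1‖ * ‖resMat z W' p.2 j‖) ≤ (1 / z.im) * (1 / z.im) :=
          h3.trans (mul_le_mul h4 h5 (nrm2_nonneg _) (by positivity))
        calc _ ≤ t * ((1 / z.im) * (1 / z.im)) := by gcongr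
          _ = _ := by field_simp
    _ = _ := by rw [Finset.sum_const, nsmul_eq_mul]

/-- perturbing one diagonal entry -/
lemma res_diff_diag {N : ℕ} {W W' : Matrix (Fin N) (Fin N) ℝ} (hW : W.IsSymm)
    (hW' : W'.IsSymm) {z : ℂ} (hz : 0 < z.im) (k : Fin N)
    (hS : ∀ i j, (i, j) ≠ (k, k) → W' i j = W i j) :
    ∑ j, |(resMat z W j j).im - (resMat z W' j j).im| ≤ 2 / z.im := by
  set x : Fin N → ℂ := fun i => ((W' k k - W k k : ℝ) : ℂ) * resMat z W i k with hx
  set y : Fin N → ℂ := fun j => resMat z W' k j with hy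
  have h1 : ∀ i j, resMat z W i j - resMat z W' i j = x i * y j := by
    intro i j
    have h2 := congrFun (congrFun (res_sub hW hW' hz) i) j
    rw [Matrix.sub_apply] at h2
    rw [h2, Matrix.mul_apply, Finset.sum_eq_single k]
    · rw [Matrix.mul_apply, Finset.sum_eq_single k]
      · simp only [hx, hy, map_apply, Matrix.sub_apply]; ring
      · intro b _ hb
        simp [hS b k (by simp [hb])]
      · simp
    · intro b _ hb
      rw [Matrix.mul_apply, Finset.sum_eq_zero, zero_mul]
      intro c _
      simp [hS c b (by simp [hb])]
    · simp
  have h3 : (resMat z W - resMat z W') *ᵥ star y = ((nrm2 y ^ 2 : ℝ) : ℂ) • x := by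
    ext i
    rw [← star_dot_self]
    simp only [mulVec, dotProduct, Matrix.sub_apply, h1, Pi.smul_apply, smul_eq_mul, Finset.sum_mul]
    refine Finset.sum_congr rfl fun j _ => ?_
    ring
  have h4 : nrm2 y ^ 2 * nrm2 x ≤ 2 / z.im * nrm2 y := by
    have h5 : nrm2 (((nrm2 y ^ 2 : ℝ) : ℂ) • x) = nrm2 y ^ 2 * nrm2 x := by
      rw [nrm2_smul, Complex.norm_real, Real.norm_of_nonneg (by positivity)]
    rw [← h5, ← h3, sub_mulVec]
    refine (nrm2_sub_le _ _).trans ?_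
    have h6 := nrm2_res_le hW hz (star y)
    have h7 := nrm2_res_le hW' hz (star y)
    rw [nrm2_star] at h6 h7
    calc _ ≤ nrm2 y / z.im + nrm2 y / z.im := add_le_add h6 h7
      _ = _ := by ring
  have h5 : nrm2 x * nrm2 y ≤ 2 / z.im := by
    rcases (nrm2_nonneg y).eq_or_lt with h | h
    · rw [← h, mul_zero]; positivity
    · refine le_of_mul_le_mul_right ?_ h
      calc _ = nrm2 y ^ 2 * nrm2 x := by ring
        _ ≤ _ := h4
  refine le_trans ?_ ((sum_norm_mul_le x y).trans h5)
  refine Finset.sum_le_sum fun j _ => ?_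
  rw [← Complex.sub_im, h1, ← norm_mul]
  exact Complex.abs_im_le_norm _



/-! ### Part 2: exponential moment bounds from bounded differences -/

lemma exp_le_add_exp_sq (x : ℝ) : Real.exp x ≤ x + Real.exp (x ^ 2) := by
  have h2 := Real.add_one_le_exp (x ^ 2)
  by_cases hx : |x| ≤ 1
  · have h := (abs_le.1 (Real.abs_exp_sub_one_sub_id_le hx)).2
    linarith
  · rw [not_le, lt_abs] at hx
    rcases hx with hx | hx
    · have : Real.exp x ≤ Real.exp (x ^ 2) := Real.exp_le_exp.2 (by nlinarith)
      linarith
    · have : Real.exp x ≤ 1 := Real.exp_le_one_iff.2 (by linarith)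
      nlinarith

/-- one step bound, finite uniform average. -/
lemma finite_exp_bound {ι : Type*} [Fintype ι] [Nonempty ι] (g : ι → ℝ) (c : ℝ)
    (hg : ∀ i j, |g i - g j| ≤ c) :
    ∑ i, Real.exp (g i) ≤ Fintype.card ι * Real.exp ((∑ i, g i) / Fintype.card ι + c ^ 2) := by
  set k : ℝ := ((Fintype.card ι : ℕ) : ℝ) with hk
  have hkpos : 0 < k := by rw [hk]; exact_mod_cast Fintype.card_pos
  set m : ℝ := (∑ i, g i) / k with hm
  have hdev : ∀ i, |g i - m| ≤ c := by
    intro i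
    have h1 : g i - m = (∑ j, (g i - g j)) / k := by
      rw [Finset.sum_sub_distrib, Finset.sum_const, Finset.card_univ, nsmul_eq_mul, ← hk, hm]
      field_simp
    rw [h1, abs_div, abs_of_pos hkpos, div_le_iff₀ hkpos]
    refine (Finset.abs_sum_le_sum_abs _ _).trans ?_
    calc _ ≤ ∑ j : ι, c := Finset.sum_le_sum fun j _ => hg i j
      _ = c * k := by rw [Finset.sum_const, Finset.card_univ, nsmul_eq_mul, ← hk]; ring
  have h2 : ∑ i, Real.exp (g i - m) ≤ k * Real.exp (c ^ 2) := by
    calc ∑ i, Real.exp (g i - m) ≤ ∑ i, ((g i - m) + Real.exp (c ^ 2)) := by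
          refine Finset.sum_le_sum fun i _ => (exp_le_add_exp_sq _).trans ?_
          have : (g i - m) ^ 2 ≤ c ^ 2 := sq_le_sq' (abs_le.1 (hdev i)).1 (abs_le.1 (hdev i)).2
          have := Real.exp_le_exp.2 this
          linarith
      _ = k * Real.exp (c ^ 2) := by
          rw [Finset.sum_add_distrib, Finset.sum_sub_distrib, Finset.sum_const, Finset.sum_const,
            Finset.card_univ, nsmul_eq_mul, nsmul_eq_mul, ← hk, hm]
          field_simp
          ring
  calc ∑ i, Real.exp (g i) = Real.exp m * ∑ i, Real.exp (g i - m) := by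
        rw [Finset.mul_sum]
        refine Finset.sum_congr rfl fun i _ => ?_
        rw [← Real.exp_add]; ring_nf
    _ ≤ Real.exp m * (k * Real.exp (c ^ 2)) := by gcongr
    _ = _ := by rw [Real.exp_add]; ring

/-- one step bound, probability measures. -/
lemma measure_exp_bound {X : Type*} [MeasurableSpace X] (μ : Measure X) [IsProbabilityMeasure μ]
    (g : X → ℝ) (hm : Measurable g) (c : ℝ) (hg : ∀ x y, |g x - g y| ≤ c) :
    ∫ x, Real.exp (g x) ∂μ ≤ Real.exp (∫ x, g x ∂μ + c ^ 2) := by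
  obtain ⟨x0⟩ : Nonempty X := by
    by_contra h
    rw [not_nonempty_iff] at h
    have := measure_univ (μ := μ)
    simp [Set.eq_empty_of_isEmpty] at this
  have hgi : Integrable g μ := by
    refine Integrable.of_bound hm.aestronglyMeasurable (|g x0| + c) (ae_of_all _ fun x => ?_)
    have h1 := hg x x0
    have h2 := abs_sub_abs_le_abs_sub (g x) (g x0)
    rw [Real.norm_eq_abs]; linarith
  set m : ℝ := ∫ x, g x ∂μ with hmdef
  have hdev : ∀ x, |g x - m| ≤ c := by
    intro x
    have h1 : g x - m = ∫ y, (g x - g y) ∂μ := by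
      rw [integral_sub (integrable_const _) hgi]; simp [hmdef]
    rw [h1, ← Real.norm_eq_abs]
    have := norm_integral_le_of_norm_le_const (μ := μ) (f := fun y => g x - g y) (C := c)
      (ae_of_all _ fun y => hg x y)
    simpa using this
  have hie : Integrable (fun x => Real.exp (g x - m)) μ := by
    refine Integrable.of_bound (by fun_prop) (Real.exp c) (ae_of_all _ fun x => ?_)
    rw [Real.norm_eq_abs, Real.abs_exp]
    exact Real.exp_le_exp.2 ((le_abs_self _).trans (hdev x))
  have h2 : ∫ x, Real.exp (g x - m) ∂μ ≤ Real.exp (c ^ 2) := by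
    calc ∫ x, Real.exp (g x - m) ∂μ ≤ ∫ x, ((g x - m) + Real.exp (c ^ 2)) ∂μ := by
          refine integral_mono hie ((hgi.sub (integrable_const _)).add (integrable_const _)) ?_
          intro x
          refine (exp_le_add_exp_sq _).trans ?_
          have : (g x - m) ^ 2 ≤ c ^ 2 := sq_le_sq' (abs_le.1 (hdev x)).1 (abs_le.1 (hdev x)).2
          have := Real.exp_le_exp.2 this
          simp only
          linarith
      _ = Real.exp (c ^ 2) := by
          have e1 : Integrable (fun x => g x - m) μ := hgi.sub (integrable_const _)
          rw [integral_add e1 (integrable_const _), integral_sub hgi (integrable_const _)]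
          simp [hmdef]
  calc ∫ x, Real.exp (g x) ∂μ = Real.exp m * ∫ x, Real.exp (g x - m) ∂μ := by
        rw [← integral_const_mul]
        refine integral_congr_ae (ae_of_all _ fun x => ?_)
        simp only
        rw [← Real.exp_add]; ring_nf
    _ ≤ Real.exp m * Real.exp (c ^ 2) := by gcongr
    _ = _ := by rw [Real.exp_add]

/-- bounded differences for product probability measures -/
lemma pi_exp_bound (ν : Measure ℝ) [IsProbabilityMeasure ν] (c : ℝ) (hc : 0 ≤ c) :
    ∀ (N : ℕ) (f : (Fin N → ℝ) → ℝ), Measurable f → (∃ B, ∀ v, |f v| ≤ B) →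
    (∀ v i x, |f (Function.update v i x) - f v| ≤ c) →
    ∫ v, Real.exp (f v) ∂(Measure.pi fun _ => ν) ≤
      Real.exp (∫ v, f v ∂(Measure.pi fun _ => ν) + N * c ^ 2) := by
  intro N
  induction N with
  | zero =>
    intro f hm _ hf
    have h : ∀ v, f v = f 0 := fun v => by rw [Subsingleton.elim v 0]
    have h1 : ∫ v, f v ∂(Measure.pi fun _ : Fin 0 => ν) = f 0 := by
      rw [integral_congr_ae (ae_of_all _ h)]; simp
    have h2 : ∫ v, Real.exp (f v) ∂(Measure.pi fun _ : Fin 0 => ν) = Real.exp (f 0) := by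
      rw [integral_congr_ae (ae_of_all _ fun v => congrArg Real.exp (h v))]; simp
    rw [h1, h2]; simp
  | succ n ih =>
    intro f hm ⟨B, hB⟩ hf
    have hsymm : ∀ p : ℝ × (Fin n → ℝ),
        (MeasurableEquiv.piFinSuccAbove (fun _ : Fin (n + 1) => ℝ) 0).symm p =
          (Fin.cons p.1 p.2 : Fin (n + 1) → ℝ) := by
      intro p
      rw [← Fin.insertNth_zero']
      rfl
    have key : ∀ g : (Fin (n + 1) → ℝ) → ℝ, Measurable g → (∃ B, ∀ v, |g v| ≤ B) →
        ∫ v, g v ∂(Measure.pi fun _ => ν) =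
          ∫ x, ∫ w, g (Fin.cons x w) ∂(Measure.pi fun _ : Fin n => ν) ∂ν := by
      intro g hg ⟨B', hB'⟩
      have e := (measurePreserving_piFinSuccAbove (fun _ : Fin (n + 1) => ν) 0).symm
      rw [← e.integral_comp', integral_prod]
      · simp only [hsymm]
      · refine Integrable.of_bound ?_ B' (ae_of_all _ fun x => hB' _)
        exact (hg.comp (MeasurableEquiv.measurable _)).aestronglyMeasurable
    have hcons : Measurable (fun p : ℝ × (Fin n → ℝ) => (Fin.cons p.1 p.2 : Fin (n + 1) → ℝ)) := by
      have := (MeasurableEquiv.piFinSuccAbove (fun _ : Fin (n + 1) => ℝ) 0).symm.measurable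
      rwa [show ⇑(MeasurableEquiv.piFinSuccAbove (fun _ : Fin (n + 1) => ℝ) 0).symm =
        fun p : ℝ × (Fin n → ℝ) => (Fin.cons p.1 p.2 : Fin (n + 1) → ℝ) from funext hsymm] at this
    have hcons' : ∀ x : ℝ, Measurable (fun w : Fin n → ℝ => (Fin.cons x w : Fin (n + 1) → ℝ)) :=
      fun x => hcons.comp measurable_prodMk_left
    rw [key f hm ⟨B, hB⟩, key (fun v => Real.exp (f v)) (by fun_prop)
      ⟨Real.exp B, fun v => by
        rw [Real.abs_exp]; exact Real.exp_le_exp.2 ((le_abs_self _).trans (hB v))⟩]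
    set F : ℝ → ℝ := fun x => ∫ w, f (Fin.cons x w) ∂(Measure.pi fun _ : Fin n => ν) with hF
    have hFm : Measurable F := by
      have : StronglyMeasurable (fun p : ℝ × (Fin n → ℝ) => f (Fin.cons p.1 p.2)) :=
        (hm.comp hcons).stronglyMeasurable
      exact (this.integral_prod_right (ν := Measure.pi fun _ : Fin n => ν)).measurable
    have hintg : ∀ x, Integrable (fun w => f (Fin.cons x w)) (Measure.pi fun _ : Fin n => ν) :=
      fun x => Integrable.of_bound (hm.comp (hcons' x)).aestronglyMeasurable B
        (ae_of_all _ fun w => hB _)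
    have hFd : ∀ x y, |F x - F y| ≤ c := by
      intro x y
      rw [hF]; simp only
      rw [← integral_sub (hintg x) (hintg y), ← Real.norm_eq_abs]
      have := norm_integral_le_of_norm_le_const (μ := Measure.pi fun _ : Fin n => ν)
        (f := fun w => f (Fin.cons x w) - f (Fin.cons y w)) (C := c)
        (ae_of_all _ fun w => by
          have := hf (Fin.cons y w) 0 x
          rwa [Fin.update_cons_zero] at this)
      simpa using this
    have hFB : ∀ x, |F x| ≤ B := by
      intro x
      have := norm_integral_le_of_norm_le_const (μ := Measure.pi fun _ : Fin n => ν)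
        (f := fun w => f (Fin.cons x w)) (C := B) (ae_of_all _ fun w => hB _)
      simpa using this
    have step : ∀ x, ∫ w, Real.exp (f (Fin.cons x w)) ∂(Measure.pi fun _ : Fin n => ν) ≤
        Real.exp (n * c ^ 2) * Real.exp (F x) := by
      intro x
      have := ih (fun w => f (Fin.cons x w)) (hm.comp (hcons' x)) ⟨B, fun w => hB _⟩ (by
        intro v i y
        have := hf (Fin.cons x v) i.succ y
        rwa [← Fin.cons_update] at this)
      rw [← Real.exp_add]
      refine this.trans (le_of_eq ?_)
      rw [add_comm (n * c ^ 2 : ℝ)]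
    have hexpF : Integrable (fun x => Real.exp (F x)) ν := by
      refine Integrable.of_bound (by fun_prop) (Real.exp B) (ae_of_all _ fun x => ?_)
      rw [Real.norm_eq_abs, Real.abs_exp]
      exact Real.exp_le_exp.2 ((le_abs_self _).trans (hFB x))
    calc ∫ x, ∫ w, Real.exp (f (Fin.cons x w)) ∂(Measure.pi fun _ : Fin n => ν) ∂ν
        ≤ ∫ x, Real.exp (n * c ^ 2) * Real.exp (F x) ∂ν := by
          refine integral_mono_of_nonneg (ae_of_all _ fun x => ?_) (hexpF.const_mul _)
            (ae_of_all _ step)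
          exact integral_nonneg fun w => (Real.exp_pos _).le
      _ = Real.exp (n * c ^ 2) * ∫ x, Real.exp (F x) ∂ν := integral_const_mul _ _
      _ ≤ Real.exp (n * c ^ 2) * Real.exp (∫ x, F x ∂ν + c ^ 2) := by
          gcongr
          exact measure_exp_bound ν F hFm c hFd
      _ = _ := by
          rw [← Real.exp_add]; push_cast; ring_nf

/-- bounded differences on the symmetric group, `Fin n` version -/
lemma perm_exp_bound_fin (c : ℝ) (hc : 0 ≤ c) :
    ∀ (n : ℕ) (f : Equiv.Perm (Fin n) → ℝ),
    (∀ σ x y, |f (Equiv.swap x y * σ) - f σ| ≤ c) →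
    ∑ σ, Real.exp (f σ) ≤
      n.factorial * Real.exp ((∑ σ, f σ) / n.factorial + n * (2 * c) ^ 2) := by
  intro n
  induction n with
  | zero =>
    intro f hf
    simp
  | succ n ih =>
    intro f hf
    have hsplit : ∀ g : Equiv.Perm (Fin (n + 1)) → ℝ, ∑ σ, g σ =
        ∑ p, ∑ e, g (Equiv.Perm.decomposeFin.symm (p, e)) := by
      intro g
      rw [← Fintype.sum_prod_type', ← Equiv.sum_comp Equiv.Perm.decomposeFin.symm]
    have hdec : ∀ (p : Fin (n + 1)) (e : Equiv.Perm (Fin n)),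
        (Equiv.Perm.decomposeFin.symm (p, e) : Equiv.Perm (Fin (n + 1))) =
          Equiv.swap 0 p * Equiv.Perm.decomposeFin.symm (0, e) := by
      intro p e
      ext x
      refine Fin.cases ?_ (fun y => ?_) x
      · simp
      · simp
    have hswap : ∀ (x y : Fin n) (e : Equiv.Perm (Fin n)),
        (Equiv.Perm.decomposeFin.symm (0, Equiv.swap x y * e) : Equiv.Perm (Fin (n + 1))) =
          Equiv.swap x.succ y.succ * Equiv.Perm.decomposeFin.symm (0, e) := by
      intro x y e
      ext z
      refine Fin.cases ?_ (fun w => ?_) z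
      · simp [Equiv.swap_apply_of_ne_of_ne (Fin.succ_ne_zero x).symm (Fin.succ_ne_zero y).symm]
      · simp only [Equiv.Perm.decomposeFin_symm_apply_succ, Equiv.swap_self, Equiv.refl_apply,
          Equiv.Perm.mul_apply]
        rw [(Fin.succ_injective n).swap_apply]
    set F : Fin (n + 1) → ℝ := fun p =>
      (∑ e, f (Equiv.Perm.decomposeFin.symm (p, e))) / n.factorial with hF
    have hfac : (0 : ℝ) < n.factorial := by exact_mod_cast n.factorial_pos
    have hFd : ∀ p q, |F p - F q| ≤ 2 * c := by
      intro p q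
      rw [hF]; simp only
      rw [← sub_div, ← Finset.sum_sub_distrib, abs_div, abs_of_pos hfac, div_le_iff₀ hfac]
      refine (Finset.abs_sum_le_sum_abs _ _).trans ?_
      calc _ ≤ ∑ e : Equiv.Perm (Fin n), 2 * c := by
            refine Finset.sum_le_sum fun e _ => ?_
            have h1 := hf (Equiv.Perm.decomposeFin.symm (0, e)) 0 p
            have h2 := hf (Equiv.Perm.decomposeFin.symm (0, e)) 0 q
            rw [hdec p, hdec q]
            rw [abs_le] at h1 h2 ⊢
            constructor <;> linarith [h1.1, h1.2, h2.1, h2.2]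
        _ = _ := by
            rw [Finset.sum_const, Finset.card_univ, Fintype.card_perm, Fintype.card_fin,
              nsmul_eq_mul]; ring
    have step : ∀ p, ∑ e, Real.exp (f (Equiv.Perm.decomposeFin.symm (p, e))) ≤
        n.factorial * Real.exp (n * (2 * c) ^ 2) * Real.exp (F p) := by
      intro p
      have := ih (fun e => f (Equiv.Perm.decomposeFin.symm (p, e))) (by
        intro e x y
        have h1 : (Equiv.Perm.decomposeFin.symm (p, Equiv.swap x y * e) :
            Equiv.Perm (Fin (n + 1))) = Equiv.swap (Equiv.swap 0 p x.succ)
              (Equiv.swap 0 p y.succ) * Equiv.Perm.decomposeFin.symm (p, e) := by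
          rw [hdec p (Equiv.swap x y * e), hdec p e, hswap, ← mul_assoc, ← mul_assoc,
            Equiv.mul_swap_eq_swap_mul]
        rw [h1]
        exact hf _ _ _)
      refine this.trans (le_of_eq ?_)
      rw [Real.exp_add, hF]; ring
    have hfin := finite_exp_bound F (2 * c) hFd
    have hsum : (∑ p, F p) / Fintype.card (Fin (n + 1)) = (∑ σ, f σ) / (n + 1).factorial := by
      rw [hsplit f, hF, ← Finset.sum_div, Fintype.card_fin, Nat.factorial_succ, div_div]
      push_cast; ring_nf
    rw [hsum] at hfin
    calc ∑ σ, Real.exp (f σ)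
        = ∑ p, ∑ e, Real.exp (f (Equiv.Perm.decomposeFin.symm (p, e))) :=
          hsplit (fun σ => Real.exp (f σ))
      _ ≤ ∑ p, n.factorial * Real.exp (n * (2 * c) ^ 2) * Real.exp (F p) :=
          Finset.sum_le_sum fun p _ => step p
      _ = n.factorial * Real.exp (n * (2 * c) ^ 2) * ∑ p, Real.exp (F p) := by
          rw [Finset.mul_sum]
      _ ≤ n.factorial * Real.exp (n * (2 * c) ^ 2) * (Fintype.card (Fin (n + 1)) *
            Real.exp ((∑ σ, f σ) / (n + 1).factorial + (2 * c) ^ 2)) := by gcongr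
      _ = _ := by
          rw [Fintype.card_fin, Nat.factorial_succ]
          push_cast
          rw [show (∑ σ, f σ) / (((n : ℝ) + 1) * n.factorial) + ((n : ℝ) + 1) * (2 * c) ^ 2 =
            n * (2 * c) ^ 2 + ((∑ σ, f σ) / (((n : ℝ) + 1) * n.factorial) + (2 * c) ^ 2) by ring]
          rw [Real.exp_add (n * (2 * c) ^ 2)]
          ring

/-- bounded differences on the symmetric group -/
lemma perm_exp_bound {P : Type*} [Fintype P] (c : ℝ) (hc : 0 ≤ c)
    (f : Equiv.Perm P → ℝ) (hf : ∀ σ x y, |f (σ * Equiv.swap x y) - f σ| ≤ c) :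
    ∑ σ, Real.exp (f σ) ≤ (Fintype.card P).factorial *
      Real.exp ((∑ σ, f σ) / (Fintype.card P).factorial + Fintype.card P * (2 * c) ^ 2) := by
  set n := Fintype.card P
  set e : P ≃ Fin n := Fintype.equivFin P
  have key : ∀ g : Equiv.Perm P → ℝ, ∑ σ, g σ = ∑ τ : Equiv.Perm (Fin n),
      g (e.permCongr.symm τ) := fun g => (Equiv.sum_comp e.permCongr.symm g).symm
  rw [key f, key fun σ => Real.exp (f σ)]
  refine perm_exp_bound_fin c hc n (fun τ => f (e.permCongr.symm τ)) ?_
  intro τ x y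
  have : e.permCongr.symm (Equiv.swap x y * τ) =
      e.permCongr.symm τ * Equiv.swap (e.symm (τ⁻¹ x)) (e.symm (τ⁻¹ y)) := by
    rw [Equiv.swap_mul_eq_mul_swap]
    ext p
    simp only [Equiv.permCongr_symm, Equiv.permCongr_apply, Equiv.Perm.mul_apply, Equiv.symm_symm]
    rw [show e (Equiv.swap (e.symm (τ⁻¹ x)) (e.symm (τ⁻¹ y)) p) = Equiv.swap (τ⁻¹ x) (τ⁻¹ y) (e p)
      by rw [e.injective.map_swap]; simp]
  rw [this]
  exact hf _ _ _



/-! ### Part 3: the configuration model -/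

/-- The ordered pair of end-vertices of the half-edge `p`, in the configuration `σ`. -/
def dartOf {N d : ℕ} (fl σ : Equiv.Perm (Fin N × Fin d)) (p : Fin N × Fin d) : Fin N × Fin N :=
  ((σ p).1, (σ (fl p)).1)

/-- half-edges that are in a loop or in a multiple edge -/
def badSet {N d : ℕ} (fl σ : Equiv.Perm (Fin N × Fin d)) : Finset (Fin N × Fin d) :=
  Finset.univ.filter (fun p => ∃ q, q ≠ p ∧ dartOf fl σ q = dartOf fl σ p)

/-- the graph of the configuration `σ` -/
def adjOf {N d : ℕ} (fl σ : Equiv.Perm (Fin N × Fin d)) : Fin N → Fin N → Bool :=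
  fun i j => decide (∃ p, dartOf fl σ p = (i, j))

/-- `fl` is a fixed point free involution. -/
def IsFlip {P : Type*} (fl : Equiv.Perm P) : Prop := (∀ p, fl (fl p) = p) ∧ (∀ p, fl p ≠ p)

lemma mem_badSet {N d : ℕ} {fl σ : Equiv.Perm (Fin N × Fin d)} {p : Fin N × Fin d} :
    p ∈ badSet fl σ ↔ ∃ q, q ≠ p ∧ dartOf fl σ q = dartOf fl σ p := by
  simp [badSet]

lemma exists_flip {P : Type*} [Fintype P] (h : Even (Fintype.card P)) :
    ∃ fl : Equiv.Perm P, IsFlip fl := by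
  obtain ⟨m, hm⟩ := h
  have e : P ≃ Fin m ⊕ Fin m := Fintype.equivOfCardEq (by simp [hm])
  refine ⟨(e.trans (Equiv.sumComm _ _)).trans e.symm, fun p => by simp, fun p hp => ?_⟩
  have : (Equiv.sumComm (Fin m) (Fin m)) (e p) = e p := by
    have := congrArg e hp
    simpa using this
  rcases h : e p with x | x <;> rw [h] at this <;> simp at this

lemma flip_conj {P : Type*} [Fintype P] {f g : Equiv.Perm P} (hf : IsFlip f) (hg : IsFlip g) :
    ∃ σ : Equiv.Perm P, σ * f * σ⁻¹ = g := by
  rcases isEmpty_or_nonempty P with hP | ⟨⟨p0⟩⟩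
  · exact ⟨1, Subsingleton.elim _ _⟩
  have key : ∀ f : Equiv.Perm P, IsFlip f →
      f.cycleType = Multiset.replicate (Fintype.card P / 2) 2 := by
    intro f hf
    have h2 : orderOf f = 2 := by
      refine orderOf_eq_prime ?_ ?_
      · ext p; simp [pow_two, hf.1]
      · intro h; exact hf.2 p0 (by rw [h]; rfl)
    obtain ⟨n, hn⟩ := Equiv.Perm.cycleType_prime_order (σ := f) (by rw [h2]; exact Nat.prime_two)
    have h3 := f.sum_cycleType
    have h4 : f.support = Finset.univ := by
      ext p; simp [hf.2 p]
    rw [h4, Finset.card_univ, hn, h2] at h3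
    rw [hn, h2, ← h3]
    simp
  have : IsConj f g := by
    rw [Equiv.Perm.isConj_iff_cycleType_eq, key f hf, key g hg]
  exact isConj_iff.1 this

/-- the set of candidates in the switching argument -/
def candSet {N d : ℕ} (fl : Equiv.Perm (Fin N × Fin d)) (p : Fin N × Fin d)
    (σ : Equiv.Perm (Fin N × Fin d)) : Finset (Fin N × Fin d) :=
  (Finset.univ.image fun k : Fin d => σ⁻¹ ((σ p).1, k)) ∪
  (Finset.univ.image fun k : Fin d × Fin d =>
    σ⁻¹ ((σ (fl (σ⁻¹ ((σ p).1, k.1)))).1, k.2))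

lemma candSet_card {N d : ℕ} (fl : Equiv.Perm (Fin N × Fin d)) (p : Fin N × Fin d)
    (σ : Equiv.Perm (Fin N × Fin d)) : (candSet fl p σ).card ≤ d + d * d := by
  refine (Finset.card_union_le _ _).trans (add_le_add ?_ ?_)
  · refine Finset.card_image_le.trans (by simp)
  · refine Finset.card_image_le.trans (by simp)

lemma mem_candSet_left {N d : ℕ} {fl : Equiv.Perm (Fin N × Fin d)} {p x : Fin N × Fin d}
    {σ : Equiv.Perm (Fin N × Fin d)} (h : (σ x).1 = (σ p).1) : x ∈ candSet fl p σ := by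
  refine Finset.mem_union_left _ (Finset.mem_image.2 ⟨(σ x).2, Finset.mem_univ _, ?_⟩)
  rw [← h]; simp

lemma mem_candSet_right {N d : ℕ} {fl : Equiv.Perm (Fin N × Fin d)} {p x q : Fin N × Fin d}
    {σ : Equiv.Perm (Fin N × Fin d)} (h : (σ q).1 = (σ p).1) (h' : (σ x).1 = (σ (fl q)).1) :
    x ∈ candSet fl p σ := by
  refine Finset.mem_union_right _ (Finset.mem_image.2 ⟨((σ q).2, (σ x).2), Finset.mem_univ _, ?_⟩)
  simp only
  rw [← h]; simp [← h']

lemma bad_swap {N d : ℕ} {fl : Equiv.Perm (Fin N × Fin d)} (hfl : IsFlip fl)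
    {p : Fin N × Fin d} {σ : Equiv.Perm (Fin N × Fin d)} (hp : p ∈ badSet fl σ) :
    ∃ E : Finset (Fin N × Fin d), E.card ≤ 4 ∧ ∀ x, x ∉ E →
      x ∈ candSet fl p (σ * Equiv.swap (fl p) x) := by
  obtain ⟨q, hqp, hq⟩ := mem_badSet.1 hp
  refine ⟨{p, fl p, q, fl q}, Finset.card_le_four, fun x hx => ?_⟩
  simp only [Finset.mem_insert, Finset.mem_singleton, not_or] at hx
  obtain ⟨hx1, hx2, hx3, hx4⟩ := hx
  have hq1 : (σ q).1 = (σ p).1 := (Prod.ext_iff.1 hq).1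
  have hq2 : (σ (fl q)).1 = (σ (fl p)).1 := (Prod.ext_iff.1 hq).2
  have hsp : (σ * Equiv.swap (fl p) x) p = σ p := by
    rw [Equiv.Perm.mul_apply, Equiv.swap_apply_of_ne_of_ne (hfl.2 p).symm (Ne.symm hx1)]
  have hsx : (σ * Equiv.swap (fl p) x) x = σ (fl p) := by
    rw [Equiv.Perm.mul_apply, Equiv.swap_apply_right]
  by_cases hqf : q = fl p
  · apply mem_candSet_left
    rw [hsp, hsx, ← hqf, hq1]
  · have hsq : (σ * Equiv.swap (fl p) x) q = σ q := by
      rw [Equiv.Perm.mul_apply, Equiv.swap_apply_of_ne_of_ne hqf (Ne.symm hx3)]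
    have hsfq : (σ * Equiv.swap (fl p) x) (fl q) = σ (fl q) := by
      rw [Equiv.Perm.mul_apply, Equiv.swap_apply_of_ne_of_ne (fun h => hqp (fl.injective h))
        (Ne.symm hx4)]
    apply mem_candSet_right (q := q)
    · rw [hsp, hsq, hq1]
    · rw [hsx, hsfq, hq2]

lemma bad_count {N d : ℕ} {fl : Equiv.Perm (Fin N × Fin d)} (hfl : IsFlip fl)
    (p : Fin N × Fin d) :
    (Finset.univ.filter fun σ : Equiv.Perm (Fin N × Fin d) => p ∈ badSet fl σ).card * (N * d - 4) ≤
      (N * d).factorial * (d + d * d) := by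
  have h1 : ∀ σ ∈ (Finset.univ.filter fun σ : Equiv.Perm (Fin N × Fin d) => p ∈ badSet fl σ),
      N * d - 4 ≤ ∑ x, if x ∈ candSet fl p (σ * Equiv.swap (fl p) x) then 1 else 0 := by
    intro σ hσ
    obtain ⟨E, hE, h⟩ := bad_swap hfl (Finset.mem_filter.1 hσ).2
    rw [← Finset.card_filter]
    calc N * d - 4 ≤ (Finset.univ : Finset (Fin N × Fin d)).card - E.card := by
          simp; omega
      _ = Eᶜ.card := by rw [Finset.card_compl, Finset.card_univ]
      _ ≤ _ := by
          refine Finset.card_le_card fun x hx => ?_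
          simp only [Finset.mem_filter, Finset.mem_univ, true_and]
          exact h x (Finset.mem_compl.1 hx)
  calc _ ≤ ∑ σ ∈ (Finset.univ.filter fun σ : Equiv.Perm (Fin N × Fin d) => p ∈ badSet fl σ),
        ∑ x, if x ∈ candSet fl p (σ * Equiv.swap (fl p) x) then 1 else 0 := by
          rw [← smul_eq_mul]
          exact Finset.card_nsmul_le_sum _ _ _ h1
    _ ≤ ∑ σ : Equiv.Perm (Fin N × Fin d),
        ∑ x, if x ∈ candSet fl p (σ * Equiv.swap (fl p) x) then 1 else 0 :=
          Finset.sum_le_sum_of_subset (Finset.filter_subset _ _)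
    _ = ∑ x, ∑ σ : Equiv.Perm (Fin N × Fin d),
        if x ∈ candSet fl p (σ * Equiv.swap (fl p) x) then 1 else 0 := Finset.sum_comm
    _ = ∑ x, ∑ σ : Equiv.Perm (Fin N × Fin d), if x ∈ candSet fl p σ then 1 else 0 := by
          refine Finset.sum_congr rfl fun x _ => ?_
          exact Equiv.sum_comp (Equiv.mulRight (Equiv.swap (fl p) x))
            (fun σ => if x ∈ candSet fl p σ then 1 else 0)
    _ = ∑ σ : Equiv.Perm (Fin N × Fin d), (candSet fl p σ).card := by
          rw [Finset.sum_comm]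
          refine Finset.sum_congr rfl fun σ _ => ?_
          rw [← Finset.card_filter]; simp
    _ ≤ ∑ σ : Equiv.Perm (Fin N × Fin d), (d + d * d) :=
          Finset.sum_le_sum fun σ _ => candSet_card fl p σ
    _ = _ := by
          rw [Finset.sum_const, Finset.card_univ, Fintype.card_perm]; simp

/-- configurations with at most `r` bad half-edges -/
def lowBad {N d : ℕ} (fl : Equiv.Perm (Fin N × Fin d)) (r : ℕ) :
    Finset (Equiv.Perm (Fin N × Fin d)) :=
  Finset.univ.filter fun σ => (badSet fl σ).card ≤ r

lemma half_lowBad {N d : ℕ} {fl : Equiv.Perm (Fin N × Fin d)} (hfl : IsFlip fl)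
    (hN : 8 ≤ N * d) (hd : 0 < d) :
    (N * d).factorial ≤ 2 * (lowBad fl (4 * (d + d * d))).card := by
  set n := N * d with hn
  set A := d + d * d with hA
  have hApos : 0 < A := by omega
  have h1 : ∑ σ : Equiv.Perm (Fin N × Fin d), (badSet fl σ).card * (n - 4) ≤
      n * (n.factorial * A) := by
    calc ∑ σ : Equiv.Perm (Fin N × Fin d), (badSet fl σ).card * (n - 4)
        = ∑ p, (Finset.univ.filter fun σ : Equiv.Perm (Fin N × Fin d) =>
            p ∈ badSet fl σ).card * (n - 4) := by
          rw [← Finset.sum_mul, ← Finset.sum_mul]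
          congr 1
          have : ∀ σ : Equiv.Perm (Fin N × Fin d), (badSet fl σ).card =
              ∑ p, if p ∈ badSet fl σ then 1 else 0 := by
            intro σ; rw [← Finset.card_filter]; simp
          simp only [this]
          rw [Finset.sum_comm]
          refine Finset.sum_congr rfl fun p _ => ?_
          rw [← Finset.card_filter]
      _ ≤ ∑ p : Fin N × Fin d, n.factorial * A := Finset.sum_le_sum fun p _ => bad_count hfl p
      _ = _ := by
          rw [Finset.sum_const, Finset.card_univ]; simp [hn]
  have h2 : ((lowBad fl (4 * A))ᶜ).card * (4 * A * (n - 4)) ≤ n * (n.factorial * A) := by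
    refine le_trans ?_ h1
    calc _ ≤ ∑ σ ∈ (lowBad fl (4 * A))ᶜ, (badSet fl σ).card * (n - 4) := by
          rw [← smul_eq_mul]
          refine Finset.card_nsmul_le_sum _ _ _ fun σ hσ => ?_
          have : 4 * A ≤ (badSet fl σ).card := by
            simp [lowBad] at hσ; omega
          gcongr
      _ ≤ _ := Finset.sum_le_sum_of_subset (Finset.subset_univ _)
  have h3 : ((lowBad fl (4 * A))ᶜ).card + (lowBad fl (4 * A)).card = n.factorial := by
    rw [Finset.card_compl_add_card, Fintype.card_perm]; simp [hn]
  have h4 : n ≤ 2 * (n - 4) := by omega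
  have h5 : ((lowBad fl (4 * A))ᶜ).card * 2 ≤ n.factorial := by
    have h6 : (((lowBad fl (4 * A))ᶜ).card * 2) * (2 * A * (n - 4)) ≤
        n.factorial * (2 * A * (n - 4)) := by
      calc _ = ((lowBad fl (4 * A))ᶜ).card * (4 * A * (n - 4)) := by ring
        _ ≤ _ := h2
        _ ≤ (2 * (n - 4)) * (n.factorial * A) := by gcongr
        _ = _ := by ring
    refine Nat.le_of_mul_le_mul_right h6 ?_
    have : 0 < n - 4 := by omega
    positivity
  omega

/-- vertices at distance at most one from `u` -/
def nearSet {N d : ℕ} (fl σ : Equiv.Perm (Fin N × Fin d)) (u : Fin N) : Finset (Fin N) :=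
  insert u (Finset.univ.image fun k : Fin d => (σ (fl (σ⁻¹ (u, k)))).1)

lemma nearSet_card {N d : ℕ} (fl σ : Equiv.Perm (Fin N × Fin d)) (u : Fin N) :
    (nearSet fl σ u).card ≤ d + 1 := by
  refine (Finset.card_insert_le _ _).trans (Nat.succ_le_succ ?_)
  refine Finset.card_image_le.trans (by simp)

lemma mem_nearSet {N d : ℕ} {fl σ : Equiv.Perm (Fin N × Fin d)} {u : Fin N} {q : Fin N × Fin d}
    (h : (σ q).1 = u) : (σ (fl q)).1 ∈ nearSet fl σ u := by
  refine Finset.mem_insert_of_mem (Finset.mem_image.2 ⟨(σ q).2, Finset.mem_univ _, ?_⟩)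
  rw [← h]; simp

lemma card_fst_mem {N d : ℕ} (σ : Equiv.Perm (Fin N × Fin d)) (Z : Finset (Fin N)) :
    (Finset.univ.filter fun r => (σ r).1 ∈ Z).card ≤ Z.card * d := by
  have : (Finset.univ.filter fun r => (σ r).1 ∈ Z).card ≤
      (Z ×ˢ (Finset.univ : Finset (Fin d))).card := by
    refine Finset.card_le_card_of_injOn σ (fun r hr => ?_) σ.injective.injOn
    simpa using hr
  simpa using this

lemma repair {N d : ℕ} {fl : Equiv.Perm (Fin N × Fin d)} (hfl : IsFlip fl)
    {σ : Equiv.Perm (Fin N × Fin d)} {K : ℕ} (hK : (badSet fl σ).card ≤ K)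
    (hn : K + 4 * (d + d * d) < N * d) (hpos : (badSet fl σ).Nonempty) :
    ∃ x y, (badSet fl (σ * Equiv.swap x y)).card < (badSet fl σ).card := by
  obtain ⟨p, hp⟩ := hpos
  set Z := nearSet fl σ (σ p).1 ∪ nearSet fl σ (σ (fl p)).1 with hZ
  have hZc : Z.card ≤ 2 * (d + 1) := by
    refine (Finset.card_union_le _ _).trans ?_
    have h1 := nearSet_card fl σ (σ p).1
    have h2 := nearSet_card fl σ (σ (fl p)).1
    omega
  obtain ⟨r, hr⟩ : ∃ r, r ∉ badSet fl σ ∪ (Finset.univ.filter (fun r => (σ r).1 ∈ Z)) ∪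
      (Finset.univ.filter (fun r => ((σ * fl) r).1 ∈ Z)) := by
    by_contra hcon
    push Not at hcon
    have h1 : (Finset.univ : Finset (Fin N × Fin d)).card ≤ _ :=
      Finset.card_le_card (fun r _ => hcon r)
    have h2 := Finset.card_union_le (badSet fl σ ∪ (Finset.univ.filter (fun r => (σ r).1 ∈ Z)))
      (Finset.univ.filter (fun r => ((σ * fl) r).1 ∈ Z))
    have h3 := Finset.card_union_le (badSet fl σ) (Finset.univ.filter (fun r => (σ r).1 ∈ Z))
    have h4 := card_fst_mem σ Z
    have h5 := card_fst_mem (σ * fl) Z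
    have h6 : (Finset.univ : Finset (Fin N × Fin d)).card = N * d := by simp
    have h7 : Z.card * d ≤ 2 * (d + 1) * d := Nat.mul_le_mul_right _ hZc
    nlinarith
  simp only [Finset.mem_union, Finset.mem_filter, Finset.mem_univ, true_and, not_or,
    Equiv.Perm.mul_apply] at hr
  obtain ⟨⟨hrb, hry⟩, hrx⟩ := hr
  replace hrx : (σ (fl r)).1 ∉ Z := fun h => hrx (Finset.mem_filter.2 ⟨Finset.mem_univ _, h⟩)
  refine ⟨fl p, r, Finset.card_lt_card ?_⟩
  set τ := σ * Equiv.swap (fl p) r with hτ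
  have hff := hfl.1
  have hfn := hfl.2
  -- basic facts
  have hu : (σ p).1 ∈ Z := Finset.mem_union_left _ (Finset.mem_insert_self _ _)
  have hv : (σ (fl p)).1 ∈ Z := Finset.mem_union_right _ (Finset.mem_insert_self _ _)
  have hnu : ∀ q, (σ q).1 = (σ p).1 → (σ (fl q)).1 ∈ Z := fun q hq =>
    Finset.mem_union_left _ (mem_nearSet hq)
  have hnv : ∀ q, (σ q).1 = (σ (fl p)).1 → (σ (fl q)).1 ∈ Z := fun q hq =>
    Finset.mem_union_right _ (mem_nearSet hq)
  have hrp : r ≠ p := fun h => hry (h ▸ hu)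
  have hrfp : r ≠ fl p := fun h => hry (h ▸ hv)
  have hfrp : fl r ≠ p := fun h => hrx (h ▸ hu)
  have hfrfp : fl r ≠ fl p := fun h => hrx (h ▸ hv)
  have hloop : (σ r).1 ≠ (σ (fl r)).1 := by
    intro h
    refine hrb (mem_badSet.2 ⟨fl r, hfn r, ?_⟩)
    simp [dartOf, hff, h]
  have t1 : τ p = σ p := by
    rw [hτ, Equiv.Perm.mul_apply, Equiv.swap_apply_of_ne_of_ne (hfn p).symm hrp.symm]
  have t2 : τ (fl p) = σ r := by
    rw [hτ, Equiv.Perm.mul_apply, Equiv.swap_apply_left]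
  have t3 : τ r = σ (fl p) := by
    rw [hτ, Equiv.Perm.mul_apply, Equiv.swap_apply_right]
  have t4 : τ (fl r) = σ (fl r) := by
    rw [hτ, Equiv.Perm.mul_apply, Equiv.swap_apply_of_ne_of_ne hfrfp (hfn r)]
  have t5 : ∀ q, q ≠ p → q ≠ fl p → q ≠ r → q ≠ fl r → dartOf fl τ q = dartOf fl σ q := by
    intro q h1 h2 h3 h4
    have h5 : fl q ≠ fl p := fun h => h1 (fl.injective h)
    have h6 : fl q ≠ r := fun h => h4 (by rw [← h, hff])
    simp only [dartOf, hτ, Equiv.Perm.mul_apply]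
    rw [Equiv.swap_apply_of_ne_of_ne h2 h3, Equiv.swap_apply_of_ne_of_ne h5 h6]
  have d1 : dartOf fl τ p = ((σ p).1, (σ r).1) := by simp [dartOf, t1, t2]
  have d2 : dartOf fl τ (fl p) = ((σ r).1, (σ p).1) := by simp [dartOf, hff, t1, t2]
  have d3 : dartOf fl τ r = ((σ (fl p)).1, (σ (fl r)).1) := by simp [dartOf, t3, t4]
  have d4 : dartOf fl τ (fl r) = ((σ (fl r)).1, (σ (fl p)).1) := by simp [dartOf, hff, t3, t4]
  -- new darts differ from the old ones
  have o1 : ∀ q, dartOf fl σ q ≠ ((σ p).1, (σ r).1) := by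
    intro q h
    have h1 : (σ q).1 = (σ p).1 := (Prod.ext_iff.1 h).1
    have h2 : (σ (fl q)).1 = (σ r).1 := (Prod.ext_iff.1 h).2
    exact hry (h2 ▸ hnu q h1)
  have o3 : ∀ q, dartOf fl σ q ≠ ((σ (fl p)).1, (σ (fl r)).1) := by
    intro q h
    have h1 : (σ q).1 = (σ (fl p)).1 := (Prod.ext_iff.1 h).1
    have h2 : (σ (fl q)).1 = (σ (fl r)).1 := (Prod.ext_iff.1 h).2
    exact hrx (h2 ▸ hnv q h1)
  have o2 : ∀ q, dartOf fl σ q ≠ ((σ r).1, (σ p).1) := by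
    intro q h
    refine o1 (fl q) ?_
    have h1 := congrArg Prod.fst h
    have h2 := congrArg Prod.snd h
    simp only [dartOf] at h1 h2
    simp [dartOf, hff, h1, h2]
  have o4 : ∀ q, dartOf fl σ q ≠ ((σ (fl r)).1, (σ (fl p)).1) := by
    intro q h
    refine o3 (fl q) ?_
    have h1 := congrArg Prod.fst h
    have h2 := congrArg Prod.snd h
    simp only [dartOf] at h1 h2
    simp [dartOf, hff, h1, h2]
  have n1 : (σ r).1 ≠ (σ p).1 := fun h => hry (h ▸ hu)
  have n2 : (σ (fl r)).1 ≠ (σ p).1 := fun h => hrx (h ▸ hu)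
  have n3 : (σ r).1 ≠ (σ (fl p)).1 := fun h => hry (h ▸ hv)
  have n4 : (σ (fl r)).1 ≠ (σ (fl p)).1 := fun h => hrx (h ▸ hv)
  have main : ∀ q q', q' ≠ q → dartOf fl τ q' = dartOf fl τ q →
      (q ≠ p ∧ q ≠ fl p ∧ q ≠ r ∧ q ≠ fl r) := by
    intro q q' hne he
    have c5 : ∀ q', (q' = p ∨ q' = fl p ∨ q' = r ∨ q' = fl r) ∨
        dartOf fl τ q' = dartOf fl σ q' := by
      intro q'
      by_cases a1 : q' = p
      · simp [a1]
      by_cases a2 : q' = fl p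
      · simp [a2]
      by_cases a3 : q' = r
      · simp [a3]
      by_cases a4 : q' = fl r
      · simp [a4]
      exact Or.inr (t5 q' a1 a2 a3 a4)
    refine ⟨?_, ?_, ?_, ?_⟩
    · rintro rfl
      rcases c5 q' with (h | h | h | h) | h
      · exact hne h
      · rw [h, d2, d1, Prod.mk.injEq] at he; exact n1 he.1
      · rw [h, d3, d1, Prod.mk.injEq] at he; exact hloop he.2.symm
      · rw [h, d4, d1, Prod.mk.injEq] at he; exact n2 he.1
      · rw [h, d1] at he; exact o1 _ he
    · rintro rfl
      rcases c5 q' with (h | h | h | h) | h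
      · rw [h, d1, d2, Prod.mk.injEq] at he; exact n1 he.1.symm
      · exact hne h
      · rw [h, d3, d2, Prod.mk.injEq] at he; exact n3 he.1.symm
      · rw [h, d4, d2, Prod.mk.injEq] at he; exact hloop he.1.symm
      · rw [h, d2] at he; exact o2 _ he
    · rintro rfl
      rcases c5 q' with (h | h | h | h) | h
      · rw [h, d1, d3, Prod.mk.injEq] at he; exact hloop he.2
      · rw [h, d2, d3, Prod.mk.injEq] at he; exact n3 he.1
      · exact hne h
      · rw [h, d4, d3, Prod.mk.injEq] at he; exact n4 he.1
      · rw [h, d3] at he; exact o3 _ he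
    · rintro rfl
      rcases c5 q' with (h | h | h | h) | h
      · rw [h, d1, d4, Prod.mk.injEq] at he; exact n2 he.1.symm
      · rw [h, d2, d4, Prod.mk.injEq] at he; exact hloop he.1
      · rw [h, d3, d4, Prod.mk.injEq] at he; exact n4 he.1.symm
      · exact hne h
      · rw [h, d4] at he; exact o4 _ he
  rw [Finset.ssubset_iff_of_subset]
  · refine ⟨p, hp, fun h => ?_⟩
    obtain ⟨q', hne, he⟩ := mem_badSet.1 h
    exact (main p q' hne he).1 rfl
  · intro q hq
    obtain ⟨q', hne, he⟩ := mem_badSet.1 hq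
    obtain ⟨a1, a2, a3, a4⟩ := main q q' hne he
    obtain ⟨b1, b2, b3, b4⟩ := main q' q hne.symm he.symm
    rw [t5 q a1 a2 a3 a4, t5 q' b1 b2 b3 b4] at he
    exact mem_badSet.2 ⟨q', hne, he⟩

lemma lowBad_step {N d : ℕ} {fl : Equiv.Perm (Fin N × Fin d)} (hfl : IsFlip fl) (r K : ℕ)
    (hr : r + 1 ≤ K) (hn : K + 4 * (d + d * d) < N * d) :
    (lowBad fl (r + 1)).card ≤ (N * d) ^ 2 * (lowBad fl r).card := by
  have hsub : lowBad fl (r + 1) ⊆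
      (((Finset.univ : Finset (Fin N × Fin d)) ×ˢ (Finset.univ : Finset (Fin N × Fin d))) ×ˢ
        lowBad fl r).image (fun w => w.2 * Equiv.swap w.1.1 w.1.2) := by
    intro σ hσ
    have hσ' : (badSet fl σ).card ≤ r + 1 := (Finset.mem_filter.1 hσ).2
    obtain ⟨x, y, h⟩ : ∃ x y, (badSet fl (σ * Equiv.swap x y)).card ≤ r := by
      by_cases hne : (badSet fl σ).Nonempty
      · obtain ⟨x, y, h⟩ := repair hfl (hσ'.trans hr) hn hne
        exact ⟨x, y, by omega⟩
      · have hcard : 0 < Fintype.card (Fin N × Fin d) := by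
          rw [Fintype.card_prod, Fintype.card_fin, Fintype.card_fin]; omega
        obtain ⟨x⟩ := Fintype.card_pos_iff.1 hcard
        refine ⟨x, x, ?_⟩
        rw [Finset.not_nonempty_iff_eq_empty] at hne
        rw [Equiv.swap_self]
        change (badSet fl (σ * 1)).card ≤ r
        rw [mul_one, hne]; simp
    refine Finset.mem_image.2 ⟨((x, y), σ * Equiv.swap x y), ?_, ?_⟩
    · simp [lowBad, h]
    · simp [mul_assoc]
  refine (Finset.card_le_card hsub).trans (Finset.card_image_le.trans (le_of_eq ?_))
  rw [Finset.card_product, Finset.card_product, Finset.card_univ]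
  simp [pow_two]

lemma lowBad_le {N d : ℕ} {fl : Equiv.Perm (Fin N × Fin d)} (hfl : IsFlip fl) (K : ℕ)
    (hn : K + 4 * (d + d * d) < N * d) (r : ℕ) (hr : r ≤ K) :
    (lowBad fl r).card ≤ ((N * d) ^ 2) ^ r * (lowBad fl 0).card := by
  induction r with
  | zero => simp
  | succ r ih =>
    refine (lowBad_step hfl r K hr hn).trans ?_
    calc _ ≤ (N * d) ^ 2 * (((N * d) ^ 2) ^ r * (lowBad fl 0).card) :=
          Nat.mul_le_mul_left _ (ih (by omega))
      _ = _ := by ring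

lemma simple_lower {N d : ℕ} {fl : Equiv.Perm (Fin N × Fin d)} (hfl : IsFlip fl) (hd : 0 < d)
    (hn : 8 * (d + d * d) < N * d) :
    (N * d).factorial ≤ 2 * (((N * d) ^ 2) ^ (4 * (d + d * d)) * (lowBad fl 0).card) := by
  refine (half_lowBad hfl (by nlinarith) hd).trans ?_
  refine Nat.mul_le_mul_left _ (lowBad_le hfl _ (by omega) _ le_rfl)

lemma mem_lowBad_zero {N d : ℕ} {fl σ : Equiv.Perm (Fin N × Fin d)} :
    σ ∈ lowBad fl 0 ↔ Function.Injective (dartOf fl σ) := by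
  simp only [lowBad, Finset.mem_filter, Finset.mem_univ, true_and, nonpos_iff_eq_zero,
    Finset.card_eq_zero]
  constructor
  · intro h q p hqp
    by_contra hne
    have : p ∈ badSet fl σ := mem_badSet.2 ⟨q, hne, hqp⟩
    rw [h] at this; simp at this
  · intro h
    ext p
    simp only [mem_badSet, Finset.notMem_empty, iff_false, not_exists, not_and]
    intro q hq he
    exact hq (h he)

lemma adjOf_symm {N d : ℕ} {fl σ : Equiv.Perm (Fin N × Fin d)} (hfl : IsFlip fl) (i j : Fin N) :
    adjOf fl σ i j = adjOf fl σ j i := by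
  have : ∀ i j, (∃ p, dartOf fl σ p = (i, j)) → ∃ p, dartOf fl σ p = (j, i) := by
    rintro i j ⟨p, hp⟩
    refine ⟨fl p, ?_⟩
    have h1 := congrArg Prod.fst hp
    have h2 := congrArg Prod.snd hp
    simp only [dartOf] at h1 h2
    simp [dartOf, hfl.1, h1, h2]
  unfold adjOf
  rw [decide_eq_decide]
  exact ⟨this i j, this j i⟩

lemma adjOf_reg {N d : ℕ} {fl σ : Equiv.Perm (Fin N × Fin d)} (hfl : IsFlip fl)
    (hσ : σ ∈ lowBad fl 0) : IsRegAdj d N (adjOf fl σ) := by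
  rw [mem_lowBad_zero] at hσ
  refine ⟨adjOf_symm hfl, fun i => ?_, fun i => ?_⟩
  · simp only [adjOf, decide_eq_false_iff_not]
    rintro ⟨p, hp⟩
    refine hfl.2 p (hσ ?_)
    have h1 := congrArg Prod.fst hp
    have h2 := congrArg Prod.snd hp
    simp only [dartOf] at h1 h2
    simp [dartOf, hfl.1, h1, h2]
  · have h1 : (Finset.univ.filter (fun j => adjOf fl σ i j = true)) =
        Finset.univ.image (fun k : Fin d => (σ (fl (σ⁻¹ (i, k)))).1) := by
      ext j
      simp only [adjOf, decide_eq_true_eq, Finset.mem_filter, Finset.mem_univ, true_and,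
        Finset.mem_image]
      constructor
      · rintro ⟨p, hp⟩
        have h1 := congrArg Prod.fst hp
        have h2 := congrArg Prod.snd hp
        simp only [dartOf] at h1 h2
        refine ⟨(σ p).2, ?_⟩
        rw [← h1]; simpa using h2
      · rintro ⟨k, hk⟩
        exact ⟨σ⁻¹ (i, k), by simpa [dartOf] using hk⟩
    rw [h1, Finset.card_image_of_injective]
    · simp
    · intro k l hkl
      have : σ⁻¹ (i, k) = σ⁻¹ (i, l) := hσ (by simpa [dartOf] using hkl)
      simpa using this

lemma adjOf_swap {N d : ℕ} {fl : Equiv.Perm (Fin N × Fin d)} (hfl : IsFlip fl)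
    (σ : Equiv.Perm (Fin N × Fin d)) (x y : Fin N × Fin d) :
    ∃ S : Finset (Fin N × Fin N), S.card ≤ 8 ∧ ∀ i j, (i, j) ∉ S →
      adjOf fl (σ * Equiv.swap x y) i j = adjOf fl σ i j := by
  set τ := σ * Equiv.swap x y with hτ
  set Q : Finset (Fin N × Fin d) := {x, y, fl x, fl y} with hQ
  have hQc : Q.card ≤ 4 := Finset.card_le_four
  refine ⟨Q.image (dartOf fl σ) ∪ Q.image (dartOf fl τ), ?_, ?_⟩
  · refine (Finset.card_union_le _ _).trans ?_
    have h1 := (Finset.card_image_le (s := Q) (f := dartOf fl σ))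
    have h2 := (Finset.card_image_le (s := Q) (f := dartOf fl τ))
    omega
  · intro i j hij
    have heq : ∀ q, q ∉ Q → dartOf fl τ q = dartOf fl σ q := by
      intro q hq
      simp only [hQ, Finset.mem_insert, Finset.mem_singleton, not_or] at hq
      obtain ⟨h1, h2, h3, h4⟩ := hq
      simp only [dartOf, hτ, Equiv.Perm.mul_apply]
      rw [Equiv.swap_apply_of_ne_of_ne h1 h2, Equiv.swap_apply_of_ne_of_ne]
      · intro h; exact h3 (by rw [← h, hfl.1])
      · intro h; exact h4 (by rw [← h, hfl.1])
    rw [Finset.mem_union, not_or] at hij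
    unfold adjOf
    rw [decide_eq_decide]
    constructor
    · rintro ⟨q, hq⟩
      have : q ∉ Q := fun h => hij.2 (Finset.mem_image.2 ⟨q, h, hq⟩)
      exact ⟨q, by rw [← heq q this, hq]⟩
    · rintro ⟨q, hq⟩
      have : q ∉ Q := fun h => hij.1 (Finset.mem_image.2 ⟨q, h, hq⟩)
      exact ⟨q, by rw [heq q this, hq]⟩

/-- every regular graph comes from a configuration -/
lemma exists_config {N d : ℕ} {fl : Equiv.Perm (Fin N × Fin d)} (hfl : IsFlip fl)
    {a : Fin N → Fin N → Bool} (ha : IsRegAdj d N a) :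
    ∃ σ ∈ lowBad fl 0, adjOf fl σ = a := by
  obtain ⟨hs, hl, hr⟩ := ha
  have e : ∀ i, {j // a i j = true} ≃ Fin d := fun i =>
    Fintype.equivFinOfCardEq (by rw [Fintype.card_subtype]; exact hr i)
  set ψ : (Σ i, {j // a i j = true}) ≃ Fin N × Fin d :=
    (Equiv.sigmaCongrRight e).trans (Equiv.sigmaEquivProd _ _) with hψ
  have hψ1 : ∀ δ, (ψ δ).1 = δ.1 := fun δ => rfl
  set sw : (Σ i, {j // a i j = true}) → (Σ i, {j // a i j = true}) :=
    fun δ => ⟨δ.2.1, δ.1, by rw [hs]; exact δ.2.2⟩ with hsw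
  have hswsw : ∀ δ, sw (sw δ) = δ := fun δ => rfl
  set m : Equiv.Perm (Fin N × Fin d) :=
    ⟨fun p => ψ (sw (ψ.symm p)), fun p => ψ (sw (ψ.symm p)), fun p => by simp [hswsw],
      fun p => by simp [hswsw]⟩ with hm
  have hmap : ∀ p, m p = ψ (sw (ψ.symm p)) := fun p => rfl
  have hmf : IsFlip m := by
    refine ⟨fun p => by simp [hmap, hswsw], fun p hp => ?_⟩
    have h1 : (m p).1 = p.1 := by rw [hp]
    rw [hmap, hψ1] at h1
    have h2 : p.1 = (ψ.symm p).1 := by rw [← hψ1]; simp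
    have h3 := (ψ.symm p).2.2
    have h4 : (ψ.symm p).2.1 = (ψ.symm p).1 := h1.trans h2
    rw [h4, hl] at h3
    simp at h3
  obtain ⟨σ, hσ⟩ := flip_conj hfl hmf
  have hconj : ∀ p, σ (fl p) = m (σ p) := by
    intro p; rw [← hσ]; simp
  have hdart : ∀ p, dartOf fl σ p = ((ψ.symm (σ p)).1, (ψ.symm (σ p)).2.1) := by
    intro p
    simp only [dartOf, hconj, hmap, hψ1, Prod.mk.injEq]
    refine ⟨?_, rfl⟩
    rw [← hψ1]; simp
  refine ⟨σ, ?_, ?_⟩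
  · rw [mem_lowBad_zero]
    intro p q hpq
    rw [hdart, hdart, Prod.mk.injEq] at hpq
    have : ψ.symm (σ p) = ψ.symm (σ q) := by
      rcases h1 : ψ.symm (σ p) with ⟨i, j, hj⟩
      rcases h2 : ψ.symm (σ q) with ⟨i', j', hj'⟩
      rw [h1, h2] at hpq
      simp only at hpq
      obtain ⟨rfl, rfl⟩ := hpq
      rfl
    exact σ.injective (ψ.symm.injective this)
  · funext i j
    have : (∃ p, dartOf fl σ p = (i, j)) ↔ a i j = true := by
      constructor
      · rintro ⟨p, hp⟩
        rw [hdart, Prod.mk.injEq] at hp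
        rcases h : ψ.symm (σ p) with ⟨i', j', hj'⟩
        rw [h] at hp
        obtain ⟨rfl, rfl⟩ := hp
        exact hj'
      · intro h
        refine ⟨σ⁻¹ (ψ ⟨i, j, h⟩), ?_⟩
        have e1 : σ (σ⁻¹ (ψ ⟨i, j, h⟩)) = ψ ⟨i, j, h⟩ := by simp
        rw [hdart, e1, Equiv.symm_apply_apply]
    unfold adjOf
    cases h : a i j <;> simp [this, h]

/-- the number of configurations above a given regular graph -/
def fibCard {N d : ℕ} (fl : Equiv.Perm (Fin N × Fin d)) : ℕ :=
  ((Finset.univ.filter fun ρ : Equiv.Perm (Fin N × Fin d) => ∀ p, ρ (fl p) = fl (ρ p)) ×ˢ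
    (Finset.univ : Finset (Fin N → Equiv.Perm (Fin d)))).card

lemma fiber_card {N d : ℕ} {fl : Equiv.Perm (Fin N × Fin d)} (hfl : IsFlip fl)
    {a : Fin N → Fin N → Bool} (ha : IsRegAdj d N a) :
    ((lowBad fl 0).filter fun σ => adjOf fl σ = a).card = fibCard fl := by
  obtain ⟨σ, hσ, hσa⟩ := exists_config hfl ha
  rw [mem_lowBad_zero] at hσ
  unfold fibCard
  symm
  have hdart : ∀ (ρ : Equiv.Perm (Fin N × Fin d)) (κ : Fin N → Equiv.Perm (Fin d)),
      (∀ p, ρ (fl p) = fl (ρ p)) → ∀ p,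
      dartOf fl (Equiv.prodShear (Equiv.refl (Fin N)) κ * σ * ρ) p = dartOf fl σ (ρ p) := by
    intro ρ κ hρ p
    simp [dartOf, Equiv.prodShear, hρ]
  refine Finset.card_bij (fun w _ => Equiv.prodShear (Equiv.refl (Fin N)) w.2 * σ * w.1) ?_ ?_ ?_
  · rintro ⟨ρ, κ⟩ h
    simp only [Finset.mem_product, Finset.mem_filter, Finset.mem_univ, true_and, and_true] at h
    rw [Finset.mem_filter, mem_lowBad_zero]
    refine ⟨fun p q hpq => ?_, ?_⟩
    · simp only [hdart ρ κ h] at hpq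
      exact ρ.injective (hσ hpq)
    · rw [← hσa]
      funext i j
      unfold adjOf
      rw [decide_eq_decide]
      simp only [hdart ρ κ h]
      exact ρ.exists_congr_left.trans (by simp)
  · rintro ⟨ρ, κ⟩ h ⟨ρ', κ'⟩ h' heq
    simp only [Finset.mem_product, Finset.mem_filter, Finset.mem_univ, true_and, and_true] at h h'
    simp only at heq
    have h1 : ρ = ρ' := by
      ext1 p
      apply hσ
      rw [← hdart ρ κ h, ← hdart ρ' κ' h', heq]
    subst h1
    have h2 := mul_right_cancel (mul_right_cancel heq)
    have h3 : κ = κ' := by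
      funext i
      ext1 k
      have := congrArg (fun e : Equiv.Perm (Fin N × Fin d) => (e (i, k)).2) h2
      simpa [Equiv.prodShear] using this
    rw [h3]
  · intro τ hτ
    rw [Finset.mem_filter, mem_lowBad_zero] at hτ
    obtain ⟨hτ, hτa⟩ := hτ
    have hex : ∀ p, ∃ q, dartOf fl σ q = dartOf fl τ p := by
      intro p
      have h1 : adjOf fl τ (dartOf fl τ p).1 (dartOf fl τ p).2 = true := by
        unfold adjOf; rw [decide_eq_true_eq]; exact ⟨p, rfl⟩
      rw [hτa, ← hσa] at h1
      unfold adjOf at h1; rw [decide_eq_true_eq] at h1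
      exact h1
    choose r hr using hex
    have hrinj : Function.Injective r := by
      intro p q h
      apply hτ
      rw [← hr, ← hr, h]
    set ρ : Equiv.Perm (Fin N × Fin d) :=
      Equiv.ofBijective r (Finite.injective_iff_bijective.1 hrinj) with hρ
    have hρr : ∀ p, ρ p = r p := fun p => rfl
    have hρ1 : ∀ p, (σ (ρ p)).1 = (τ p).1 := fun p => (Prod.ext_iff.1 (hr p)).1
    have hρ2 : ∀ p, (σ (fl (ρ p))).1 = (τ (fl p)).1 := fun p => (Prod.ext_iff.1 (hr p)).2
    have hcomm : ∀ p, ρ (fl p) = fl (ρ p) := by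
      intro p
      apply hσ
      rw [hρr, hr]
      simp only [dartOf, hfl.1, hρ1, hρ2]
    set K : Equiv.Perm (Fin N × Fin d) := τ * ρ⁻¹ * σ⁻¹ with hK
    have hK1 : ∀ x, (K x).1 = x.1 := by
      intro x
      have := hρ1 (ρ⁻¹ (σ⁻¹ x))
      have e1 : ρ (ρ⁻¹ (σ⁻¹ x)) = σ⁻¹ x := by simp
      have e2 : σ (σ⁻¹ x) = x := by simp
      rw [e1, e2] at this
      rw [hK]; simp only [Equiv.Perm.mul_apply]; exact this.symm
    have hK2 : ∀ x, (K⁻¹ x).1 = x.1 := by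
      intro x
      have := hK1 (K⁻¹ x)
      simpa using this.symm
    have hKp : ∀ i k, K (i, k) = (i, (K (i, k)).2) := fun i k => by
      ext1
      · exact hK1 _
      · rfl
    have hKp' : ∀ i k, K⁻¹ (i, k) = (i, (K⁻¹ (i, k)).2) := fun i k => by
      ext1
      · exact hK2 _
      · rfl
    set κ : Fin N → Equiv.Perm (Fin d) := fun i =>
      ⟨fun k => (K (i, k)).2, fun k => (K⁻¹ (i, k)).2, fun k => by
        simp only [← hKp]; simp, fun k => by simp only [← hKp']; simp⟩ with hκ
    refine ⟨(ρ, κ), by simp [hcomm], ?_⟩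
    have : Equiv.prodShear (Equiv.refl (Fin N)) κ = K := by
      ext1 ⟨i, k⟩
      rw [hKp]
      simp [Equiv.prodShear, hκ]
    simp only [this, hK]
    simp [mul_assoc]



/-! ### Part 4: concentration for the uniform regular graph -/

/-- the i.i.d. Gaussian potential -/
abbrev gaussPi (N : ℕ) : Measure (Fin N → ℝ) := Measure.pi fun _ => gaussianReal 0 1

/-- the finite set of regular graphs -/
def regSet (d N : ℕ) : Finset (Fin N → Fin N → Bool) :=
  Finset.univ.filter (fun a => IsRegAdj d N a)

lemma graphMeasure_prob {d N : ℕ} (h : (regSet d N).Nonempty) :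
    IsProbabilityMeasure (graphMeasure d N) := by
  obtain ⟨a, ha⟩ := h
  have : IsProbabilityMeasure (uniformOn {a | IsRegAdj d N a}) :=
    isProbabilityMeasure_uniformOn (Set.toFinite _) ⟨a, by simpa [regSet] using ha⟩
  unfold graphMeasure
  infer_instance

lemma meas_of_slices {N : ℕ} {F : (Fin N → Fin N → Bool) × (Fin N → ℝ) → ℝ}
    (hm : ∀ a, Measurable fun v => F (a, v)) : Measurable F :=
  measurable_from_prod_countable_right hm

lemma graph_integrable {d N : ℕ} (h : (regSet d N).Nonempty)
    {F : (Fin N → Fin N → Bool) × (Fin N → ℝ) → ℝ}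
    (hm : ∀ a, Measurable fun v => F (a, v)) {B : ℝ}
    (hB : ∀ a ∈ regSet d N, ∀ v, |F (a, v)| ≤ B) : Integrable F (graphMeasure d N) := by
  have := graphMeasure_prob h
  refine Integrable.of_bound (C := B) (meas_of_slices hm).aestronglyMeasurable ?_
  have h1 : ∀ᵐ a ∂(uniformOn {a | IsRegAdj d N a}), a ∈ regSet d N := by
    rw [ae_iff]
    have : IsProbabilityMeasure (uniformOn {a | IsRegAdj d N a}) :=
      isProbabilityMeasure_uniformOn (Set.toFinite _) (by
        obtain ⟨a, ha⟩ := h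
        exact ⟨a, by simpa [regSet] using ha⟩)
    have hset : {a | a ∉ regSet d N} = {a | IsRegAdj d N a}ᶜ := by
      ext a; simp [regSet]
    rw [hset]
    unfold uniformOn
    rw [cond_apply (Set.toFinite _).measurableSet]
    simp
  have h2 := (Measure.quasiMeasurePreserving_fst (μ := uniformOn {a | IsRegAdj d N a})
    (ν := gaussPi N)).ae h1
  filter_upwards [h2] with ω hω
  exact hB ω.1 hω ω.2

lemma graph_integral {d N : ℕ} (h : (regSet d N).Nonempty)
    {F : (Fin N → Fin N → Bool) × (Fin N → ℝ) → ℝ}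
    (hm : ∀ a, Measurable fun v => F (a, v)) {B : ℝ}
    (hB : ∀ a ∈ regSet d N, ∀ v, |F (a, v)| ≤ B) :
    ∫ ω, F ω ∂(graphMeasure d N) =
      (∑ a ∈ regSet d N, ∫ v, F (a, v) ∂(gaussPi N)) / (regSet d N).card := by
  have hp : IsProbabilityMeasure (uniformOn {a | IsRegAdj d N a}) :=
    isProbabilityMeasure_uniformOn (Set.toFinite _) (by
      obtain ⟨a, ha⟩ := h
      exact ⟨a, by simpa [regSet] using ha⟩)
  have hi := graph_integrable h hm hB
  unfold graphMeasure at hi ⊢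
  rw [integral_prod _ hi, integral_fintype (Integrable.of_finite)]
  have hs : ∀ a, (uniformOn {a | IsRegAdj d N a}).real {a} =
      if a ∈ regSet d N then ((regSet d N).card : ℝ)⁻¹ else 0 := by
    intro a
    have hset : {a | IsRegAdj d N a} = (regSet d N : Set (Fin N → Fin N → Bool)) := by
      ext a; simp [regSet]
    unfold uniformOn Measure.real
    rw [hset, cond_apply (Finset.measurableSet _), Measure.count_apply_finset]
    split_ifs with ha
    · rw [Set.inter_eq_right.2 (by simpa using ha)]
      simp
    · have : (regSet d N : Set (Fin N → Fin N → Bool)) ∩ {a} = ∅ := by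
        ext b; simp; rintro hb rfl; exact ha hb
      rw [this]; simp
  simp only [hs, smul_eq_mul, ite_mul, zero_mul, Finset.sum_ite_mem, Finset.univ_inter]
  rw [← Finset.mul_sum, div_eq_inv_mul]

lemma sum_lowBad {N d : ℕ} {fl : Equiv.Perm (Fin N × Fin d)} (hfl : IsFlip fl)
    (g : (Fin N → Fin N → Bool) → ℝ) :
    ∑ σ ∈ lowBad fl 0, g (adjOf fl σ) = (fibCard fl : ℝ) * ∑ a ∈ regSet d N, g a := by
  rw [← Finset.sum_fiberwise_of_maps_to (t := regSet d N) (g := adjOf fl)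
    (fun σ hσ => by simpa [regSet] using adjOf_reg hfl hσ)]
  rw [Finset.mul_sum]
  refine Finset.sum_congr rfl fun a ha => ?_
  have ha' : IsRegAdj d N a := by simpa [regSet] using ha
  rw [← fiber_card hfl ha']
  rw [Finset.sum_congr rfl (g := fun _ => g a)]
  · simp
  · intro σ hσ
    rw [(Finset.mem_filter.1 hσ).2]

/-- configuration-model mean -/
def cfgMean {N d : ℕ} (fl : Equiv.Perm (Fin N × Fin d))
    (f : (Fin N → Fin N → Bool) → (Fin N → ℝ) → ℝ) : ℝ :=
  (∑ σ : Equiv.Perm (Fin N × Fin d), ∫ v, f (adjOf fl σ) v ∂(gaussPi N)) / (N * d).factorial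

/-- the price of conditioning on simplicity -/
def simpCost (d N : ℕ) : ℝ := 2 * (((N : ℝ) * d) ^ 2) ^ (4 * (d + d * d))

lemma regSet_nonempty {N d : ℕ} (hd : 0 < d) (hn : 8 * (d + d * d) < N * d) (he : Even (N * d)) :
    (regSet d N).Nonempty := by
  obtain ⟨fl, hfl⟩ := exists_flip (P := Fin N × Fin d) (by simpa using he)
  have h := simple_lower hfl hd hn
  have : (lowBad fl 0).Nonempty := by
    rw [Finset.nonempty_iff_ne_empty]
    intro h0
    rw [h0] at h
    have := Nat.factorial_pos (N * d)
    simp at h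
    omega
  obtain ⟨σ, hσ⟩ := this
  exact ⟨adjOf fl σ, by simpa [regSet] using adjOf_reg hfl hσ⟩

lemma perm_exp_bound_dec {P : Type*} [Fintype P] [inst : DecidableEq P] (c : ℝ) (hc : 0 ≤ c)
    (f : Equiv.Perm P → ℝ) (hf : ∀ σ x y, |f (σ * Equiv.swap x y) - f σ| ≤ c) :
    ∑ σ, Real.exp (f σ) ≤ (Fintype.card P).factorial *
      Real.exp ((∑ σ, f σ) / (Fintype.card P).factorial + Fintype.card P * (2 * c) ^ 2) := by
  obtain rfl : inst = fun a b => Classical.propDecidable (a = b) := Subsingleton.elim _ _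
  exact perm_exp_bound c hc f hf

lemma graph_exp_bound {N d : ℕ} {fl : Equiv.Perm (Fin N × Fin d)} (hfl : IsFlip fl)
    (hd : 0 < d) (hn : 8 * (d + d * d) < N * d) (he : Even (N * d))
    (f : (Fin N → Fin N → Bool) → (Fin N → ℝ) → ℝ) (hm : ∀ a, Measurable (f a))
    {B c1 c2 : ℝ} (hc1 : 0 ≤ c1) (hc2 : 0 ≤ c2)
    (hB : ∀ a, (∀ i j, a i j = a j i) → ∀ v, |f a v| ≤ B)
    (h2 : ∀ a, (∀ i j, a i j = a j i) → ∀ v i x, |f a (Function.update v i x) - f a v| ≤ c2)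
    (h1 : ∀ a a', (∀ i j, a i j = a j i) → (∀ i j, a' i j = a' j i) →
      ∀ S : Finset (Fin N × Fin N), S.card ≤ 8 → (∀ i j, (i, j) ∉ S → a' i j = a i j) →
      ∀ v, |f a' v - f a v| ≤ c1) :
    ∫ ω, Real.exp (f ω.1 ω.2) ∂(graphMeasure d N) ≤
      simpCost d N * Real.exp (cfgMean fl f + (N * c2 ^ 2 + (N * d : ℝ) * (2 * c1) ^ 2)) := by
  have hR := regSet_nonempty hd hn he
  have hsymR : ∀ a ∈ regSet d N, ∀ i j, a i j = a j i := by
    intro a ha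
    have : IsRegAdj d N a := by simpa [regSet] using ha
    exact this.1
  have hintg : ∀ a, (∀ i j, a i j = a j i) → Integrable (f a) (gaussPi N) := fun a ha =>
    Integrable.of_bound (hm a).aestronglyMeasurable B (ae_of_all _ (hB a ha))
  rw [graph_integral (F := fun ω => Real.exp (f ω.1 ω.2)) hR
    (fun a => Real.measurable_exp.comp (hm a)) (B := Real.exp B) (by
      intro a ha v
      rw [abs_of_pos (Real.exp_pos _)]
      exact Real.exp_le_exp.2 ((le_abs_self _).trans (hB a (hsymR a ha) v)))]
  set g : (Fin N → Fin N → Bool) → ℝ := fun a => ∫ v, Real.exp (f a v) ∂(gaussPi N) with hg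
  have hg0 : ∀ a, 0 ≤ g a := fun a => integral_nonneg fun v => (Real.exp_pos _).le
  have hL := sum_lowBad hfl (fun _ => 1)
  have hL' := sum_lowBad hfl g
  simp only [Finset.sum_const, nsmul_eq_mul, mul_one] at hL
  have hlow := simple_lower hfl hd hn
  have hRpos : (0 : ℝ) < (regSet d N).card := by exact_mod_cast hR.card_pos
  have hlow' : ((N * d).factorial : ℝ) ≤ simpCost d N * (lowBad fl 0).card := by
    unfold simpCost
    have : ((N * d).factorial : ℝ) ≤
      ((2 * (((N * d) ^ 2) ^ (4 * (d + d * d)) * (lowBad fl 0).card) : ℕ) : ℝ) := by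
        exact_mod_cast hlow
    push_cast at this
    linarith
  have hfact : (0 : ℝ) < (N * d).factorial := by exact_mod_cast Nat.factorial_pos _
  have hsc : 0 ≤ simpCost d N := by unfold simpCost; positivity
  have hlpos : (0 : ℝ) < (lowBad fl 0).card := by
    by_contra hcon
    have : ((lowBad fl 0).card : ℝ) = 0 := le_antisymm (not_lt.1 hcon) (by positivity)
    rw [this] at hlow'
    linarith
  have hfpos : (0 : ℝ) < fibCard fl := by
    by_contra hcon
    have : (fibCard fl : ℝ) = 0 := le_antisymm (not_lt.1 hcon) (by positivity)
    rw [this] at hL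
    linarith
  have hratio : (∑ a ∈ regSet d N, g a) / (regSet d N).card =
      (∑ σ ∈ lowBad fl 0, g (adjOf fl σ)) / (lowBad fl 0).card := by
    rw [hL', hL]
    field_simp
  change (∑ a ∈ regSet d N, g a) / (regSet d N).card ≤ _
  rw [hratio, div_le_iff₀ hlpos]
  have hcard : Fintype.card (Fin N × Fin d) = N * d := by simp
  have hkey : ∀ (σ : Equiv.Perm (Fin N × Fin d)) (x y : Fin N × Fin d),
      |(∫ v, f (adjOf fl (σ * Equiv.swap x y)) v ∂(gaussPi N)) -
        ∫ v, f (adjOf fl σ) v ∂(gaussPi N)| ≤ c1 := by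
      intro σ x y
      obtain ⟨S, hS, hS'⟩ := adjOf_swap hfl σ x y
      have hsa := fun i j => adjOf_symm (σ := σ) hfl i j
      have hsb := fun i j => adjOf_symm (σ := σ * Equiv.swap x y) hfl i j
      rw [← integral_sub (hintg _ hsb) (hintg _ hsa)]
      have := norm_integral_le_of_norm_le_const (μ := gaussPi N)
        (f := fun v => f (adjOf fl (σ * Equiv.swap x y)) v - f (adjOf fl σ) v) (C := c1)
        (ae_of_all _ (h1 _ _ hsa hsb S hS hS'))
      simpa using this
  have hperm : ∑ σ : Equiv.Perm (Fin N × Fin d),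
      Real.exp (∫ v, f (adjOf fl σ) v ∂(gaussPi N)) ≤ (N * d).factorial *
        Real.exp (cfgMean fl f + ((N * d : ℕ) : ℝ) * (2 * c1) ^ 2) := by
    have hp := perm_exp_bound_dec (P := Fin N × Fin d) c1 hc1
      (fun σ => ∫ v, f (adjOf fl σ) v ∂(gaussPi N)) hkey
    rw [hcard] at hp
    unfold cfgMean
    exact hp
  calc ∑ σ ∈ lowBad fl 0, g (adjOf fl σ) ≤ ∑ σ, g (adjOf fl σ) :=
        Finset.sum_le_sum_of_subset_of_nonneg (Finset.subset_univ _) (fun σ _ _ => hg0 _)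
    _ ≤ ∑ σ, Real.exp ((∫ v, f (adjOf fl σ) v ∂(gaussPi N)) + N * c2 ^ 2) := by
        refine Finset.sum_le_sum fun σ _ => ?_
        have hsa := fun i j => adjOf_symm (σ := σ) hfl i j
        exact pi_exp_bound (gaussianReal 0 1) c2 hc2 N _ (hm _) ⟨B, hB _ hsa⟩ (h2 _ hsa)
    _ = Real.exp (N * c2 ^ 2) * ∑ σ, Real.exp (∫ v, f (adjOf fl σ) v ∂(gaussPi N)) := by
        rw [Finset.mul_sum]
        refine Finset.sum_congr rfl fun σ _ => ?_
        rw [Real.exp_add, mul_comm]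
    _ ≤ Real.exp (N * c2 ^ 2) * ((N * d).factorial *
          Real.exp (cfgMean fl f + ((N * d : ℕ) : ℝ) * (2 * c1) ^ 2)) := by
        gcongr
    _ = (N * d).factorial *
          Real.exp (cfgMean fl f + (N * c2 ^ 2 + (N * d : ℝ) * (2 * c1) ^ 2)) := by
        push_cast
        simp only [Real.exp_add]
        ring
    _ ≤ (simpCost d N * (lowBad fl 0).card) *
          Real.exp (cfgMean fl f + (N * c2 ^ 2 + (N * d : ℝ) * (2 * c1) ^ 2)) := by gcongr
    _ = _ := by ring

lemma cfgMean_neg {N d : ℕ} (fl : Equiv.Perm (Fin N × Fin d))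
    (f : (Fin N → Fin N → Bool) → (Fin N → ℝ) → ℝ) :
    cfgMean fl (fun a v => - f a v) = - cfgMean fl f := by
  unfold cfgMean
  simp only [integral_neg, Finset.sum_neg_distrib, neg_div]

/-- one-sided consequences of an exponential moment bound -/
lemma exp_tail {Ω : Type*} [MeasurableSpace Ω] (P : Measure Ω) [IsProbabilityMeasure P]
    (X : Ω → ℝ) (hX : Integrable X P) (hE : Integrable (fun ω => Real.exp (X ω)) P)
    (M m κ : ℝ) (hM : 0 < M) (h : ∫ ω, Real.exp (X ω) ∂P ≤ M * Real.exp (m + κ)) :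
    (∀ u, P.real {ω | m + u ≤ X ω} ≤ M * Real.exp (κ - u)) ∧
      ∫ ω, X ω ∂P ≤ m + (Real.log M + κ) := by
  constructor
  · intro u
    have h1 := mul_meas_ge_le_integral_of_nonneg (μ := P) (f := fun ω => Real.exp (X ω))
      (ae_of_all _ fun ω => (Real.exp_pos _).le) hE (Real.exp (m + u))
    simp only [Real.exp_le_exp] at h1
    have h2 := h1.trans h
    rw [← le_div_iff₀' (Real.exp_pos _)] at h2
    refine h2.trans (le_of_eq ?_)
    rw [mul_div_assoc, ← Real.exp_sub]
    congr 2
    ring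
  · set k := m + (Real.log M + κ) with hk
    have h1 : ∫ ω, (X ω - k + 1) ∂P ≤ ∫ ω, Real.exp (X ω) * Real.exp (-k) ∂P := by
      refine integral_mono ((hX.sub (integrable_const _)).add (integrable_const _))
        (hE.mul_const _) fun ω => ?_
      simp only
      rw [← Real.exp_add, ← sub_eq_add_neg]
      exact Real.add_one_le_exp _
    have hs1 : Integrable (fun ω => X ω - k) P := hX.sub (integrable_const _)
    rw [integral_mul_const, integral_add hs1 (integrable_const _),
      integral_sub hX (integrable_const _)] at h1
    simp only [integral_const, probReal_univ, smul_eq_mul, one_mul] at h1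
    have h2 : (∫ ω, Real.exp (X ω) ∂P) * Real.exp (-k) ≤ 1 := by
      calc _ ≤ (M * Real.exp (m + κ)) * Real.exp (-k) := by gcongr
        _ = Real.exp (Real.log M) * Real.exp (m + κ) * Real.exp (-k) := by rw [Real.exp_log hM]
        _ = Real.exp 0 := by rw [← Real.exp_add, ← Real.exp_add]; congr 1; rw [hk]; ring
        _ = 1 := Real.exp_zero
    linarith

lemma graph_conc {N d : ℕ} (hd : 0 < d) (hn : 8 * (d + d * d) < N * d) (he : Even (N * d))
    (f : (Fin N → Fin N → Bool) → (Fin N → ℝ) → ℝ) (hm : ∀ a, Measurable (f a))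
    {B c1 c2 : ℝ} (hc1 : 0 ≤ c1) (hc2 : 0 ≤ c2)
    (hB : ∀ a, (∀ i j, a i j = a j i) → ∀ v, |f a v| ≤ B)
    (h2 : ∀ a, (∀ i j, a i j = a j i) → ∀ v i x, |f a (Function.update v i x) - f a v| ≤ c2)
    (h1 : ∀ a a', (∀ i j, a i j = a j i) → (∀ i j, a' i j = a' j i) →
      ∀ S : Finset (Fin N × Fin N), S.card ≤ 8 → (∀ i j, (i, j) ∉ S → a' i j = a i j) →
      ∀ v, |f a' v - f a v| ≤ c1)
    (κ : ℝ) (hκ : N * c2 ^ 2 + (N * d : ℝ) * (2 * c1) ^ 2 ≤ κ) (u : ℝ)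
    (hu : Real.log (simpCost d N) + κ ≤ u) :
    (graphMeasure d N).real {ω | 2 * u < |f ω.1 ω.2 - ∫ ω', f ω'.1 ω'.2 ∂(graphMeasure d N)|} ≤
      2 * (simpCost d N * Real.exp (κ - u)) := by
  obtain ⟨fl, hfl⟩ := exists_flip (P := Fin N × Fin d) (by simpa using he)
  have hR := regSet_nonempty hd hn he
  have hprob := graphMeasure_prob hR
  have hsymR : ∀ a ∈ regSet d N, ∀ i j, a i j = a j i := by
    intro a ha
    have : IsRegAdj d N a := by simpa [regSet] using ha
    exact this.1
  have hM : 0 < simpCost d N := by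
    unfold simpCost
    have : 0 < N * d := by omega
    have : (0 : ℝ) < (N : ℝ) * d := by exact_mod_cast this
    positivity
  have hi := graph_integrable (F := fun ω => f ω.1 ω.2) hR hm (B := B)
    (fun a ha v => hB a (hsymR a ha) v)
  have hie : ∀ ε : ℝ, |ε| = 1 → Integrable (fun ω => Real.exp (ε * f ω.1 ω.2)) (graphMeasure d N) := by
    intro ε hε
    refine graph_integrable (F := fun ω => Real.exp (ε * f ω.1 ω.2)) hR
      (fun a => Real.measurable_exp.comp ((hm a).const_mul ε)) (B := Real.exp B) ?_
    intro a ha v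
    rw [abs_of_pos (Real.exp_pos _)]
    refine Real.exp_le_exp.2 ((le_abs_self _).trans ?_)
    rw [abs_mul, hε, one_mul]
    exact hB a (hsymR a ha) v
  have b1 := graph_exp_bound hfl hd hn he f hm hc1 hc2 hB h2 h1
  have b2 := graph_exp_bound hfl hd hn he (fun a v => - f a v) (fun a => (hm a).neg) hc1 hc2
    (fun a ha v => by rw [abs_neg]; exact hB a ha v)
    (fun a ha v i x => by rw [neg_sub_neg, abs_sub_comm]; exact h2 a ha v i x)
    (fun a a' ha ha' S hS hS' v => by
      rw [neg_sub_neg, abs_sub_comm]; exact h1 a a' ha ha' S hS hS' v)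
  rw [cfgMean_neg] at b2
  have i1 := hie 1 (by simp)
  have i2 := hie (-1) (by simp)
  simp only [one_mul, neg_mul] at i1 i2
  obtain ⟨t1, e1⟩ := exp_tail (graphMeasure d N) (fun ω => f ω.1 ω.2) hi i1 _ (cfgMean fl f) κ hM
    (b1.trans (by gcongr))
  obtain ⟨t2, e2⟩ := exp_tail (graphMeasure d N) (fun ω => - f ω.1 ω.2) hi.neg i2 _
    (-cfgMean fl f) κ hM (b2.trans (by gcongr))
  rw [integral_neg] at e2
  have hsub : {ω : (Fin N → Fin N → Bool) × (Fin N → ℝ) | 2 * u < |f ω.1 ω.2 - ∫ ω', f ω'.1 ω'.2 ∂(graphMeasure d N)|} ⊆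
      {ω : (Fin N → Fin N → Bool) × (Fin N → ℝ) | cfgMean fl f + u ≤ f ω.1 ω.2} ∪
        {ω | -cfgMean fl f + u ≤ - f ω.1 ω.2} := by
    intro ω hω
    simp only [Set.mem_ofPred_eq, Set.mem_union] at hω ⊢
    rcases lt_abs.1 hω with h | h
    · left; linarith
    · right; linarith
  calc _ ≤ (graphMeasure d N).real _ := measureReal_mono hsub
    _ ≤ _ := measureReal_union_le _ _
    _ ≤ simpCost d N * Real.exp (κ - u) + simpCost d N * Real.exp (κ - u) :=
        add_le_add (t1 u) (t2 u)
    _ = _ := by ring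



/-! ### Part 5: the observable -/

lemma ae_reg {d N : ℕ} : ∀ᵐ ω ∂(graphMeasure d N), ω.1 ∈ regSet d N := by
  have h1 : ∀ᵐ a ∂(uniformOn {a | IsRegAdj d N a}), a ∈ regSet d N := by
    rw [ae_iff]
    have hset : {a | a ∉ regSet d N} = {a | IsRegAdj d N a}ᶜ := by
      ext a; simp [regSet]
    rw [hset]
    unfold uniformOn
    rw [cond_apply (Set.toFinite _).measurableSet]
    simp
  exact (Measure.quasiMeasurePreserving_fst (μ := uniformOn {a | IsRegAdj d N a})
    (ν := gaussPi N)).ae h1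

lemma reg_symm {d N : ℕ} {a : Fin N → Fin N → Bool} (ha : a ∈ regSet d N) :
    ∀ i j, a i j = a j i := by
  have : IsRegAdj d N a := by simpa [regSet] using ha
  exact this.1

lemma Wmat_symm (t : ℝ) {N : ℕ} {a : Fin N → Fin N → Bool} (ha : ∀ i j, a i j = a j i)
    (v : Fin N → ℝ) : (Wmat t a v).IsSymm := by
  ext i j
  simp only [Wmat, Matrix.transpose_apply, ha j i]
  congr 1
  by_cases h : i = j
  · subst h; simp
  · simp [h, Ne.symm h]

lemma imG_measurable (t : ℝ) (z : ℂ) {N : ℕ} (a : Fin N → Fin N → Bool) (j : Fin N) :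
    Measurable fun v => imG t z (a, v) j := by
  have hc : Continuous fun v : Fin N → ℝ => (Wmat t a v).map (fun x => (x : ℂ)) - z • 1 := by
    refine Continuous.sub ?_ continuous_const
    refine continuous_matrix fun i k => ?_
    simp only [Matrix.map_apply, Wmat]
    refine Complex.continuous_ofReal.comp (continuous_const.add ?_)
    split_ifs
    · exact continuous_apply i
    · exact continuous_const
  unfold imG resMat
  simp only [Matrix.inv_def, Ring.inverse_eq_inv', Matrix.smul_apply, smul_eq_mul]
  refine Complex.measurable_im.comp (Measurable.mul ?_ ?_)
  · exact hc.matrix_det.measurable.inv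
  · exact (hc.matrix_adjugate.matrix_elem j j).measurable

lemma imG_perm (t : ℝ) (z : ℂ) {N : ℕ} (a : Fin N → Fin N → Bool) (v : Fin N → ℝ)
    (τ : Equiv.Perm (Fin N)) (j : Fin N) :
    imG t z (fun i k => a (τ i) (τ k), fun i => v (τ i)) j = imG t z (a, v) (τ j) := by
  have h1 : Wmat t (fun i k => a (τ i) (τ k)) (fun i => v (τ i)) =
      (Wmat t a v).submatrix τ τ := by
    ext i k
    simp [Wmat]
  unfold imG resMat
  simp only [h1]
  have h2 : ((Wmat t a v).submatrix τ τ).map (fun x => (x : ℂ)) - z • (1 : Matrix _ _ ℂ) =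
      ((Wmat t a v).map (fun x => (x : ℂ)) - z • 1).submatrix τ τ := by
    ext i k
    simp [Matrix.one_apply]
  rw [h2, Matrix.inv_submatrix_equiv]
  rfl

lemma reg_perm {d N : ℕ} {a : Fin N → Fin N → Bool} (ha : a ∈ regSet d N)
    (τ : Equiv.Perm (Fin N)) : (fun i k => a (τ i) (τ k)) ∈ regSet d N := by
  have h : IsRegAdj d N a := by simpa [regSet] using ha
  have : IsRegAdj d N (fun i k => a (τ i) (τ k)) := by
    refine ⟨fun i j => h.1 _ _, fun i => h.2.1 _, fun i => ?_⟩
    rw [← h.2.2 (τ i)]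
    refine Finset.card_bij (fun j _ => τ j) ?_ ?_ ?_
    · intro j hj; simpa using hj
    · intro j _ k _ hjk; exact τ.injective hjk
    · intro j hj; exact ⟨τ.symm j, by simpa using hj, by simp⟩
  simpa [regSet] using this

lemma integral_gauss_perm {N : ℕ} (τ : Equiv.Perm (Fin N)) (F : (Fin N → ℝ) → ℝ) :
    ∫ v, F (fun i => v (τ i)) ∂(gaussPi N) = ∫ v, F v ∂(gaussPi N) := by
  have h := measurePreserving_piCongrLeft (α := fun _ : Fin N => ℝ)
    (fun _ : Fin N => gaussianReal 0 1) τ.symm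
  have h2 := h.integral_comp' (g := F)
  rw [← h2]
  refine integral_congr_ae (ae_of_all _ fun v => ?_)
  simp only
  congr 1
  funext i
  have := Equiv.piCongrLeft_apply_apply (fun _ : Fin N => ℝ) τ.symm v (τ i)
  simp only [Equiv.symm_apply_apply] at this
  exact this.symm

lemma imG_bounds {t : ℝ} {z : ℂ} (hz : 0 < z.im) {N : ℕ} {a : Fin N → Fin N → Bool}
    (ha : ∀ i j, a i j = a j i) (v : Fin N → ℝ) (j : Fin N) :
    0 ≤ imG t z (a, v) j ∧ imG t z (a, v) j ≤ 1 / z.im :=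
  ⟨im_res_nonneg (Wmat_symm t ha v) hz j, im_res_le (Wmat_symm t ha v) hz j⟩

lemma imG_pow_bound {t s : ℝ} (hs : 0 < s) {z : ℂ} (hz : 0 < z.im) {N : ℕ}
    {a : Fin N → Fin N → Bool}
    (ha : ∀ i j, a i j = a j i) (v : Fin N → ℝ) (j : Fin N) :
    |imG t z (a, v) j ^ s| ≤ (1 / z.im) ^ s := by
  obtain ⟨h1, h2⟩ := imG_bounds (t := t) hz ha v j
  rw [abs_of_nonneg (Real.rpow_nonneg h1 _)]
  exact Real.rpow_le_rpow h1 h2 hs.le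

lemma imG_exch {d N : ℕ} (hR : (regSet d N).Nonempty) {t s : ℝ} (hs : 0 < s) {z : ℂ}
    (hz : 0 < z.im) (j k : Fin N) :
    ∫ ω, imG t z ω j ^ s ∂(graphMeasure d N) = ∫ ω, imG t z ω k ^ s ∂(graphMeasure d N) := by
  set τ : Equiv.Perm (Fin N) := Equiv.swap j k with hτ
  have hττ : ∀ i, τ (τ i) = i := fun i => by simp [hτ]
  rw [graph_integral (F := fun ω => imG t z ω j ^ s) hR
    (fun a => (imG_measurable t z a j).pow_const s)
    (fun a ha v => imG_pow_bound hs hz (reg_symm ha) v j),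
    graph_integral (F := fun ω => imG t z ω k ^ s) hR
    (fun a => (imG_measurable t z a k).pow_const s)
    (fun a ha v => imG_pow_bound hs hz (reg_symm ha) v k)]
  congr 1
  refine Finset.sum_bij (fun a _ => fun i k => a (τ i) (τ k)) (fun a ha => reg_perm ha τ) ?_ ?_ ?_
  · intro a _ b _ hab
    funext i l
    have := congrFun (congrFun hab (τ i)) (τ l)
    simpa [hττ] using this
  · intro a ha
    exact ⟨_, reg_perm ha τ, by funext i l; simp [hττ]⟩
  · intro a ha
    rw [← integral_gauss_perm τ (fun v => imG t z (fun i k => a (τ i) (τ k), v) k ^ s)]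
    refine integral_congr_ae (ae_of_all _ fun v => ?_)
    simp only
    rw [imG_perm]
    simp [hτ]

/-- regularised power -/
def regPow (δ s x : ℝ) : ℝ := max x δ ^ s

lemma regPow_diff {δ s x : ℝ} (hδ : 0 < δ) (hs : 0 < s) (hx : 0 ≤ x) :
    |regPow δ s x - x ^ s| ≤ δ ^ s := by
  unfold regPow
  rcases le_total δ x with h | h
  · rw [max_eq_left h, sub_self, abs_zero]; positivity
  · rw [max_eq_right h]
    have h1 : x ^ s ≤ δ ^ s := Real.rpow_le_rpow hx h hs.le
    have h2 : 0 ≤ x ^ s := Real.rpow_nonneg hx s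
    rw [abs_of_nonneg (by linarith)]; linarith

lemma regPow_bound {δ s x b : ℝ} (hδ : 0 < δ) (hs : 0 < s) (hb : δ ≤ b) (hx : x ≤ b) :
    |regPow δ s x| ≤ b ^ s := by
  unfold regPow
  have h0 : 0 ≤ max x δ := hδ.le.trans (le_max_right _ _)
  rw [abs_of_nonneg (Real.rpow_nonneg h0 _)]
  exact Real.rpow_le_rpow h0 (max_le hx hb) hs.le

lemma regPow_lip {δ s b x y : ℝ} (hδ : 0 < δ) (hs : 0 < s) (hb : δ ≤ b) (hx : x ≤ b) (hy : y ≤ b) :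
    |regPow δ s x - regPow δ s y| ≤ s * (b ^ s / δ) * |x - y| := by
  have hbp : 0 < b := hδ.trans_le hb
  have h1 := (convex_Icc δ b).norm_image_sub_le_of_norm_hasDerivWithin_le
    (f := fun x : ℝ => x ^ s) (f' := fun x => s * x ^ (s - 1)) (C := s * (b ^ s / δ))
    (x := max y δ) (y := max x δ)
    (fun u hu => (Real.hasDerivAt_rpow_const (Or.inl (hδ.trans_le hu.1).ne')).hasDerivWithinAt)
    (fun u hu => by
      have hu0 : 0 < u := hδ.trans_le hu.1
      rw [Real.norm_of_nonneg (by positivity), Real.rpow_sub_one hu0.ne']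
      have : u ^ s ≤ b ^ s := Real.rpow_le_rpow hu0.le hu.2 hs.le
      have := hu.1
      gcongr)
    ⟨le_max_right _ _, max_le hy hb⟩ ⟨le_max_right _ _, max_le hx hb⟩
  have h2 : |max x δ - max y δ| ≤ |x - y| := abs_max_sub_max_le_abs _ _ _
  calc |regPow δ s x - regPow δ s y| ≤ s * (b ^ s / δ) * |max x δ - max y δ| := h1
    _ ≤ _ := by gcongr

lemma regPow_measurable (δ s : ℝ) : Measurable (regPow δ s) := by
  unfold regPow
  exact (measurable_id.max measurable_const).pow_const s

/-- the regularised observable -/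
def regObs (δ s t : ℝ) (z : ℂ) {N : ℕ} (a : Fin N → Fin N → Bool) (v : Fin N → ℝ) : ℝ :=
  (1 / (N : ℝ)) * ∑ j, regPow δ s (imG t z (a, v) j)

lemma regObs_measurable (δ s t : ℝ) (z : ℂ) {N : ℕ} (a : Fin N → Fin N → Bool) :
    Measurable (regObs δ s t z a) := by
  unfold regObs
  exact (Finset.measurable_fun_sum _ fun j _ =>
    (regPow_measurable δ s).comp (imG_measurable t z a j)).const_mul _

lemma avg_abs_le {N : ℕ} (hN : 0 < N) (g : Fin N → ℝ) (B : ℝ) (h : ∀ j, |g j| ≤ B) :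
    |(1 / (N : ℝ)) * ∑ j, g j| ≤ B := by
  have hN' : (0 : ℝ) < N := by exact_mod_cast hN
  rw [abs_mul, abs_of_pos (by positivity)]
  have : |∑ j, g j| ≤ N * B := by
    refine (Finset.abs_sum_le_sum_abs _ _).trans ?_
    refine (Finset.sum_le_sum fun j _ => h j).trans ?_
    simp
  calc 1 / (N : ℝ) * |∑ j, g j| ≤ 1 / (N : ℝ) * (N * B) := by gcongr
    _ = B := by field_simp

lemma regObs_diff {δ s t : ℝ} (hδ : 0 < δ) (hs : 0 < s) {z : ℂ} (hz : 0 < z.im)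
    (hb : δ ≤ 1 / z.im) {N : ℕ}
    {a a' : Fin N → Fin N → Bool} (ha : ∀ i j, a i j = a j i) (ha' : ∀ i j, a' i j = a' j i)
    (v v' : Fin N → ℝ) (D : ℝ)
    (hD : ∑ j, |imG t z (a, v) j - imG t z (a', v') j| ≤ D) :
    |regObs δ s t z a v - regObs δ s t z a' v'| ≤
      (1 / (N : ℝ)) * (s * ((1 / z.im) ^ s / δ) * D) := by
  unfold regObs
  rw [← mul_sub, ← Finset.sum_sub_distrib, abs_mul, abs_of_nonneg (by positivity)]
  have hL : 0 ≤ s * ((1 / z.im) ^ s / δ) := by positivity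
  refine mul_le_mul_of_nonneg_left ?_ (by positivity)
  refine (Finset.abs_sum_le_sum_abs _ _).trans ?_
  refine (Finset.sum_le_sum fun j _ => regPow_lip hδ hs hb (imG_bounds hz ha v j).2
    (imG_bounds hz ha' v' j).2).trans ?_
  rw [← Finset.mul_sum]
  gcongr

lemma regObs_update {δ s t : ℝ} (hδ : 0 < δ) (hs : 0 < s) {z : ℂ} (hz : 0 < z.im)
    (hb : δ ≤ 1 / z.im) {N : ℕ}
    {a : Fin N → Fin N → Bool} (ha : ∀ i j, a i j = a j i) (v : Fin N → ℝ) (i : Fin N) (x : ℝ) :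
    |regObs δ s t z a (Function.update v i x) - regObs δ s t z a v| ≤
      (1 / (N : ℝ)) * (s * ((1 / z.im) ^ s / δ) * (2 / z.im)) := by
  refine regObs_diff hδ hs hz hb ha ha _ _ _ ?_
  refine res_diff_diag (Wmat_symm t ha _) (Wmat_symm t ha _) hz i ?_
  intro k l hkl
  simp only [Wmat]
  by_cases h : k = l
  · subst h
    have : k ≠ i := fun h => hkl (by rw [h])
    simp [Function.update_of_ne this]
  · simp [h]

lemma regObs_graph {δ s t : ℝ} (ht : 0 < t) (hδ : 0 < δ) (hs : 0 < s) {z : ℂ} (hz : 0 < z.im)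
    (hb : δ ≤ 1 / z.im) {N : ℕ}
    {a a' : Fin N → Fin N → Bool} (ha : ∀ i j, a i j = a j i) (ha' : ∀ i j, a' i j = a' j i)
    (S : Finset (Fin N × Fin N)) (hS : S.card ≤ 8) (hS' : ∀ i j, (i, j) ∉ S → a' i j = a i j)
    (v : Fin N → ℝ) :
    |regObs δ s t z a' v - regObs δ s t z a v| ≤
      (1 / (N : ℝ)) * (s * ((1 / z.im) ^ s / δ) * (8 * (t / z.im ^ 2))) := by
  refine regObs_diff hδ hs hz hb ha' ha _ _ _ ?_
  refine (res_diff_entries (Wmat_symm t ha' v) (Wmat_symm t ha v) hz S t ?_ ?_).trans ?_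
  · intro i j hij
    simp only [Wmat, hS' i j hij]
  · intro i j
    simp only [Wmat, add_sub_add_right_eq_sub]
    split_ifs <;> simp [abs_of_pos ht, ht.le]
  · have : (S.card : ℝ) ≤ 8 := by exact_mod_cast hS
    gcongr



/-! ### Part 6: asymptotics and conclusion -/

/-- the bound for the exponent in terms of `ℓ = log N` -/
def kapFun (s t : ℝ) (d : ℕ) (l : ℝ) : ℝ :=
  (s * (l ^ s * (8 * l) ^ (1 / s))) ^ 2 * (4 * l ^ 2 + 256 * d * t ^ 2 * l ^ 4)

lemma kapFun_le {s t : ℝ} (hs : 0 < s) (d : ℕ) {m : ℕ} (hm : s ≤ m) (hm' : 1 / s ≤ m)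
    {l : ℝ} (hl : 1 ≤ l) :
    kapFun s t d l ≤ ((s * 8 ^ m) ^ 2 * (4 + 256 * d * t ^ 2)) * l ^ (4 * m + 4) := by
  have h1 : l ^ s ≤ l ^ m := by
    rw [← Real.rpow_natCast]; exact Real.rpow_le_rpow_of_exponent_le hl hm
  have h2 : (8 * l) ^ (1 / s) ≤ (8 * l) ^ m := by
    rw [← Real.rpow_natCast]; exact Real.rpow_le_rpow_of_exponent_le (by linarith) hm'
  have h3 : l ^ 2 ≤ l ^ 4 := pow_le_pow_right₀ hl (by norm_num)
  unfold kapFun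
  have hl0 : 0 < l := by linarith
  calc _ ≤ (s * (l ^ m * (8 * l) ^ m)) ^ 2 * (4 * l ^ 4 + 256 * d * t ^ 2 * l ^ 4) := by
        gcongr
    _ = _ := by rw [mul_pow]; ring

lemma log_simpCost {d N : ℕ} (hd : 0 < d) (hN : 0 < N) :
    Real.log (simpCost d N) =
      Real.log 2 + (4 * (d + d * d) : ℕ) * (2 * (Real.log N + Real.log d)) := by
  have h1 : (N : ℝ) ≠ 0 := by exact_mod_cast hN.ne'
  have h2 : (d : ℝ) ≠ 0 := by exact_mod_cast hd.ne'
  unfold simpCost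
  rw [Real.log_mul (by norm_num) (by positivity), Real.log_pow, Real.log_pow, Real.log_mul h1 h2]
  norm_num

lemma asympt {s t : ℝ} (hs : 0 < s) {d : ℕ} (hd : 0 < d) :
    ∀ᶠ N : ℕ in atTop, Real.log 2 + Real.log (simpCost d N) + kapFun s t d (Real.log N) +
      100 * Real.log N ≤ √N / (4 * Real.log N) := by
  obtain ⟨m, hm⟩ := exists_nat_ge (max s (1 / s))
  have hm1 : s ≤ m := (le_max_left _ _).trans hm
  have hm2 : 1 / s ≤ m := (le_max_right _ _).trans hm
  set K : ℝ := ((4 * (d + d * d) : ℕ) : ℝ) with hK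
  have hK0 : 0 ≤ K := by positivity
  have hld : 0 ≤ Real.log d := Real.log_natCast_nonneg d
  have hl2 : 0 ≤ Real.log 2 := Real.log_nonneg (by norm_num)
  set A : ℝ := 2 * Real.log 2 + K * (2 * (1 + Real.log d)) +
    ((s * 8 ^ m) ^ 2 * (4 + 256 * d * t ^ 2)) + 100 with hA
  have hA0 : 0 < A := by positivity
  have hlo := (isLittleO_log_rpow_rpow_atTop (s := 1 / 2) ((4 * m + 5 : ℕ) : ℝ) (by norm_num)).def
    (c := 1 / (4 * A)) (by positivity)
  have hlo' := tendsto_natCast_atTop_atTop.eventually hlo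
  have hl1 : ∀ᶠ N : ℕ in atTop, 1 ≤ Real.log N :=
    (Real.tendsto_log_atTop.comp tendsto_natCast_atTop_atTop).eventually_ge_atTop 1
  filter_upwards [hlo', hl1, eventually_gt_atTop 0] with N h1 h2 h3
  set l := Real.log N with hl
  have hl0 : 0 < l := by linarith
  rw [Real.rpow_natCast, Real.norm_of_nonneg (by positivity), Real.norm_of_nonneg (by positivity),
    ← Real.sqrt_eq_rpow] at h1
  rw [log_simpCost hd h3, le_div_iff₀ (by positivity)]
  have hk := kapFun_le (t := t) hs d hm1 hm2 h2
  have hp1 : 1 ≤ l ^ (4 * m + 4) := one_le_pow₀ h2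
  have hp2 : l ≤ l ^ (4 * m + 4) := le_self_pow₀ h2 (by omega)
  have hbound : Real.log 2 + (Real.log 2 + K * (2 * (l + Real.log d))) + kapFun s t d l +
      100 * l ≤ A * l ^ (4 * m + 4) := by
    set q := l ^ (4 * m + 4) with hq
    have e1 : Real.log 2 ≤ Real.log 2 * q := le_mul_of_one_le_right hl2 hp1
    have e2 : K * (2 * (l + Real.log d)) ≤ K * (2 * (q + Real.log d * q)) := by
      have : Real.log d ≤ Real.log d * q := le_mul_of_one_le_right hld hp1
      gcongr
    rw [hA]
    nlinarith
  calc _ ≤ A * l ^ (4 * m + 4) * (4 * l) := by gcongr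
    _ = (4 * A) * l ^ (4 * m + 5) := by ring
    _ ≤ (4 * A) * (1 / (4 * A) * √N) := by gcongr
    _ = √N := by field_simp

lemma large_N {s t : ℝ} (hs : 0 < s) (ht : 0 < t) {d N : ℕ} (hd : 0 < d) (hN : 0 < N)
    (hn : 8 * (d + d * d) < N * d) (he : Even (N * d)) (hl1 : 1 ≤ Real.log N)
    (has : Real.log 2 + Real.log (simpCost d N) + kapFun s t d (Real.log N) +
      100 * Real.log N ≤ √N / (4 * Real.log N))
    {z : ℂ} (hη : (Real.log N)⁻¹ ≤ z.im) (hη1 : z.im ≤ 1) (j0 : Fin N) :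
    (graphMeasure d N).real
      {ω | |(1 / (N : ℝ)) * ∑ j, imG t z ω j ^ s -
        ∫ ω', imG t z ω' j0 ^ s ∂(graphMeasure d N)| ≤ z.im}ᶜ ≤ (N : ℝ) ^ (-100 : ℝ) := by
  set η := z.im with hηdef
  set l := Real.log N with hl
  have hl0 : 0 < l := by linarith
  have hη0 : 0 < η := lt_of_lt_of_le (by positivity) hη
  have hN0 : (0 : ℝ) < N := by exact_mod_cast hN
  have hηl : 1 / η ≤ l := by
    rw [div_le_iff₀ hη0]
    calc 1 = l * l⁻¹ := by field_simp
      _ ≤ l * η := by gcongr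
  have hR := regSet_nonempty hd hn he
  have hprob := graphMeasure_prob hR
  set δ : ℝ := (η / 8) ^ (1 / s) with hδdef
  have hδ : 0 < δ := by positivity
  have hδs : δ ^ s = η / 8 := by
    rw [hδdef, ← Real.rpow_mul (by positivity)]
    rw [one_div_mul_cancel hs.ne', Real.rpow_one]
  have hδ1 : δ ≤ 1 := Real.rpow_le_one (by positivity) (by linarith) (by positivity)
  have hb : δ ≤ 1 / η := hδ1.trans (by rw [le_div_iff₀ hη0]; linarith)
  set Lp : ℝ := s * ((1 / η) ^ s / δ) with hLp
  have hLp0 : 0 < Lp := by positivity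
  have hLple : Lp ≤ s * (l ^ s * (8 * l) ^ (1 / s)) := by
    have e1 : 1 / δ = (8 * (1 / η)) ^ (1 / s) := by
      rw [hδdef, one_div (_ ^ _), ← Real.inv_rpow (by positivity)]
      congr 1
      field_simp
    rw [hLp, div_eq_mul_one_div, e1]
    gcongr
  -- the rescaled observable
  set f : (Fin N → Fin N → Bool) → (Fin N → ℝ) → ℝ := fun a v => √N * regObs δ s t z a v with hf
  have hsq : 0 < √(N : ℝ) := Real.sqrt_pos.2 hN0
  have hsq2 : √(N : ℝ) ^ 2 = N := Real.sq_sqrt hN0.le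
  have hobs : ∀ a : Fin N → Fin N → Bool, (∀ i j, a i j = a j i) → ∀ v, |regObs δ s t z a v| ≤ (1 / η) ^ s := by
    intro a ha v
    exact avg_abs_le hN _ _ fun j => regPow_bound hδ hs hb (imG_bounds hη0 ha v j).2
  set c1 : ℝ := √N * ((1 / (N : ℝ)) * (Lp * (8 * (t / η ^ 2)))) with hc1
  set c2 : ℝ := √N * ((1 / (N : ℝ)) * (Lp * (2 / η))) with hc2
  have hκ : N * c2 ^ 2 + (N * d : ℝ) * (2 * c1) ^ 2 ≤ kapFun s t d l := by
    have e : N * c2 ^ 2 + (N * d : ℝ) * (2 * c1) ^ 2 =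
        Lp ^ 2 * (4 * (1 / η) ^ 2 + 256 * d * t ^ 2 * (1 / η) ^ 4) := by
      rw [hc1, hc2]
      simp only [mul_pow, hsq2]
      field_simp
      ring
    rw [e]
    unfold kapFun
    gcongr
  set u : ℝ := √N * η / 4 with hu
  have hul : √N / (4 * l) ≤ u := by
    rw [hu, div_le_iff₀ (by positivity)]
    have : 1 ≤ η * l := by
      rw [div_le_iff₀ hη0] at hηl; linarith
    nlinarith
  have hl2 : 0 ≤ Real.log 2 := Real.log_nonneg (by norm_num)
  have hconc := graph_conc hd hn he f (fun a => (regObs_measurable δ s t z a).const_mul _)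
    (B := √N * (1 / η) ^ s) (c1 := c1) (c2 := c2) (by positivity) (by positivity)
    (fun a ha v => by
      rw [hf]; simp only
      rw [abs_mul, abs_of_pos hsq]
      exact mul_le_mul_of_nonneg_left (hobs a ha v) hsq.le)
    (fun a ha v i x => by
      rw [hf]; simp only
      rw [← mul_sub, abs_mul, abs_of_pos hsq]
      exact mul_le_mul_of_nonneg_left (regObs_update hδ hs hη0 hb ha v i x) hsq.le)
    (fun a a' ha ha' S hS hS' v => by
      rw [hf]; simp only
      rw [← mul_sub, abs_mul, abs_of_pos hsq]
      exact mul_le_mul_of_nonneg_left (regObs_graph ht hδ hs hη0 hb ha ha' S hS hS' v) hsq.le)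
    (kapFun s t d l) hκ u (by linarith)
  -- numerical bound
  have hM : 0 < simpCost d N := by
    unfold simpCost
    have : (0 : ℝ) < d := by exact_mod_cast hd
    positivity
  have hnum : 2 * (simpCost d N * Real.exp (kapFun s t d l - u)) ≤ (N : ℝ) ^ (-100 : ℝ) := by
    rw [Real.rpow_def_of_pos hN0]
    calc 2 * (simpCost d N * Real.exp (kapFun s t d l - u))
        = Real.exp (Real.log 2) * (Real.exp (Real.log (simpCost d N)) *
            Real.exp (kapFun s t d l - u)) := by
          rw [Real.exp_log hM, Real.exp_log (by norm_num)]
      _ = Real.exp (Real.log 2 + (Real.log (simpCost d N) + (kapFun s t d l - u))) := by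
          rw [Real.exp_add, Real.exp_add]
      _ ≤ _ := by
          refine Real.exp_le_exp.2 ?_
          linarith
  refine le_trans ?_ (hconc.trans hnum)
  -- inclusion of events
  have hif : Integrable (fun ω => regObs δ s t z ω.1 ω.2) (graphMeasure d N) :=
    graph_integrable (F := fun ω => regObs δ s t z ω.1 ω.2) hR
      (fun a => regObs_measurable δ s t z a) (fun a ha v => hobs a (reg_symm ha) v)
  have hij : ∀ j, Integrable (fun ω => imG t z ω j ^ s) (graphMeasure d N) := fun j =>
    graph_integrable (F := fun ω => imG t z ω j ^ s) hR
      (fun a => (imG_measurable t z a j).pow_const s)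
      (fun a ha v => imG_pow_bound hs hη0 (reg_symm ha) v j)
  have hiY : Integrable (fun ω => (1 / (N : ℝ)) * ∑ j, imG t z ω j ^ s) (graphMeasure d N) :=
    (integrable_finsetSum _ fun j _ => hij j).const_mul _
  have hEY : ∫ ω, (1 / (N : ℝ)) * ∑ j, imG t z ω j ^ s ∂(graphMeasure d N) =
      ∫ ω', imG t z ω' j0 ^ s ∂(graphMeasure d N) := by
    rw [integral_const_mul, integral_finsetSum _ fun j _ => hij j]
    rw [Finset.sum_congr rfl fun j _ => imG_exch hR hs hη0 j j0]
    simp only [Finset.sum_const, Finset.card_univ, Fintype.card_fin, nsmul_eq_mul]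
    field_simp
  have hclose : ∀ᵐ ω ∂(graphMeasure d N),
      |(1 / (N : ℝ)) * ∑ j, imG t z ω j ^ s - regObs δ s t z ω.1 ω.2| ≤ η / 8 := by
    filter_upwards [ae_reg] with ω hω
    unfold regObs
    rw [← mul_sub, ← Finset.sum_sub_distrib, ← hδs]
    refine avg_abs_le hN _ _ fun j => ?_
    rw [abs_sub_comm]
    exact regPow_diff hδ hs (imG_bounds hη0 (reg_symm hω) ω.2 j).1
  have hEclose : |(∫ ω', imG t z ω' j0 ^ s ∂(graphMeasure d N)) -
      ∫ ω, regObs δ s t z ω.1 ω.2 ∂(graphMeasure d N)| ≤ η / 8 := by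
    rw [← hEY, ← integral_sub hiY hif]
    have := norm_integral_le_of_norm_le_const (μ := graphMeasure d N)
      (f := fun ω => (1 / (N : ℝ)) * ∑ j, imG t z ω j ^ s - regObs δ s t z ω.1 ω.2)
      (C := η / 8) hclose
    simpa using this
  have hEf : ∫ ω, f ω.1 ω.2 ∂(graphMeasure d N) =
      √N * ∫ ω, regObs δ s t z ω.1 ω.2 ∂(graphMeasure d N) := by
    rw [hf, integral_const_mul]
  rw [hEf]
  unfold Measure.real
  refine ENNReal.toReal_mono (measure_ne_top _ _) (measure_mono_ae ?_)
  filter_upwards [hclose] with ω hω hbad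
  replace hbad : ¬ (|(1 / (N : ℝ)) * ∑ j, imG t z ω j ^ s -
        ∫ ω', imG t z ω' j0 ^ s ∂(graphMeasure d N)| ≤ η) := hbad
  suffices hgoal : 2 * u < |√N * regObs δ s t z ω.1 ω.2 -
      √N * ∫ ω, regObs δ s t z ω.1 ω.2 ∂(graphMeasure d N)| from hgoal
  by_contra hcon
  push Not at hcon
  apply hbad
  rw [← mul_sub, abs_mul, abs_of_pos hsq, hu] at hcon
  have hc : |regObs δ s t z ω.1 ω.2 - ∫ ω, regObs δ s t z ω.1 ω.2 ∂(graphMeasure d N)| ≤ η / 2 := by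
    refine le_of_mul_le_mul_left (hcon.trans (le_of_eq ?_)) hsq
    ring
  rw [abs_le] at *
  constructor <;> linarith [hω.1, hω.2, hc.1, hc.2, hEclose.1, hEclose.2]

lemma big_eta {s t : ℝ} (hs : 0 < s) {d N : ℕ} (hN : 0 < N)
    (hR : (regSet d N).Nonempty) {z : ℂ} (hη1 : 1 ≤ z.im) (j0 : Fin N) :
    (graphMeasure d N).real
      {ω | |(1 / (N : ℝ)) * ∑ j, imG t z ω j ^ s -
        ∫ ω', imG t z ω' j0 ^ s ∂(graphMeasure d N)| ≤ z.im}ᶜ ≤ 0 := by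
  have hprob := graphMeasure_prob hR
  have hη0 : 0 < z.im := by linarith
  have hN0 : (0 : ℝ) < N := by exact_mod_cast hN
  have hb : ∀ a ∈ regSet d N, ∀ v j, 0 ≤ imG t z (a, v) j ^ s ∧ imG t z (a, v) j ^ s ≤ 1 := by
    intro a ha v j
    obtain ⟨h1, h2⟩ := imG_bounds (t := t) hη0 (reg_symm ha) v j
    refine ⟨Real.rpow_nonneg h1 _, Real.rpow_le_one h1 (h2.trans ?_) hs.le⟩
    rw [div_le_one hη0]; exact hη1
  have hb' : ∀ᵐ ω ∂(graphMeasure d N), ∀ j, 0 ≤ imG t z ω j ^ s ∧ imG t z ω j ^ s ≤ 1 := by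
    filter_upwards [ae_reg] with ω hω
    exact hb ω.1 hω ω.2
  have hi : Integrable (fun ω => imG t z ω j0 ^ s) (graphMeasure d N) :=
    graph_integrable (F := fun ω => imG t z ω j0 ^ s) hR
      (fun a => (imG_measurable t z a j0).pow_const s)
      (fun a ha v => imG_pow_bound hs hη0 (reg_symm ha) v j0)
  have hI0 : 0 ≤ ∫ ω', imG t z ω' j0 ^ s ∂(graphMeasure d N) :=
    integral_nonneg_of_ae (by filter_upwards [hb'] with ω hω using (hω j0).1)
  have hI1 : ∫ ω', imG t z ω' j0 ^ s ∂(graphMeasure d N) ≤ 1 := by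
    calc _ ≤ ∫ _, (1 : ℝ) ∂(graphMeasure d N) :=
          integral_mono_ae hi (integrable_const _)
            (by filter_upwards [hb'] with ω hω using (hω j0).2)
      _ = 1 := by simp
  have hz : graphMeasure d N {ω | |(1 / (N : ℝ)) * ∑ j, imG t z ω j ^ s -
        ∫ ω', imG t z ω' j0 ^ s ∂(graphMeasure d N)| ≤ z.im}ᶜ = 0 := by
    change _ = _
    have : ∀ᵐ ω ∂(graphMeasure d N), |(1 / (N : ℝ)) * ∑ j, imG t z ω j ^ s -
        ∫ ω', imG t z ω' j0 ^ s ∂(graphMeasure d N)| ≤ z.im := by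
      filter_upwards [hb'] with ω hω
      have h1 : 0 ≤ (1 / (N : ℝ)) * ∑ j, imG t z ω j ^ s :=
        mul_nonneg (by positivity) (Finset.sum_nonneg fun j _ => (hω j).1)
      have h2 : (1 / (N : ℝ)) * ∑ j, imG t z ω j ^ s ≤ 1 :=
        (le_abs_self _).trans (avg_abs_le hN _ 1 fun j => by
          rw [abs_of_nonneg (hω j).1]; exact (hω j).2)
      rw [abs_le]
      constructor <;> linarith
    exact this
  unfold Measure.real
  rw [hz]; simp


theorem stmt1 (s : ℝ) (hs : 0 < s) (t : ℝ) (ht : 0 < t) (d : ℕ) (hd : 3 ≤ d) :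
    ∃ C : ℝ, 1 < C ∧
      ∀ N : ℕ, ∀ _hN : d + 1 ≤ N, Even (N * d) →
        ∀ E η : ℝ, (Real.log N)⁻¹ ≤ η →
          ENNReal.ofReal (1 - C * (N : ℝ) ^ (-100 : ℝ)) ≤
            graphMeasure d N
              {ω | |(1 / (N : ℝ)) * ∑ j, imG t (E + η * Complex.I) ω j ^ s -
                  ∫ ω', imG t (E + η * Complex.I) ω' (⟨0, by omega⟩ : Fin N) ^ s
                    ∂(graphMeasure d N)| ≤ η} := by
  have hd0 : 0 < d := by omega
  have hl1 : ∀ᶠ N : ℕ in atTop, 1 ≤ Real.log N :=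
    (Real.tendsto_log_atTop.comp tendsto_natCast_atTop_atTop).eventually_ge_atTop 1
  obtain ⟨N0, hN0⟩ := eventually_atTop.1 ((asympt (t := t) hs hd0).and
    (hl1.and (eventually_gt_atTop (8 * (d + d * d)))))
  refine ⟨(N0 : ℝ) ^ (100 : ℝ) + 2, ?_, ?_⟩
  · have : (0 : ℝ) ≤ (N0 : ℝ) ^ (100 : ℝ) := by positivity
    linarith
  intro N hN he E η hη
  have hNpos : 0 < N := by omega
  have hNr : (0 : ℝ) < N := by exact_mod_cast hNpos
  have hNp : (0 : ℝ) < (N : ℝ) ^ (-100 : ℝ) := Real.rpow_pos_of_pos hNr _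
  have hC0 : (0 : ℝ) ≤ (N0 : ℝ) ^ (100 : ℝ) := by positivity
  rcases lt_or_ge N N0 with hlt | hge
  · have h1 : 1 ≤ (N0 : ℝ) ^ (100 : ℝ) * (N : ℝ) ^ (-100 : ℝ) := by
      rw [Real.rpow_neg hNr.le, ← div_eq_mul_inv, le_div_iff₀ (Real.rpow_pos_of_pos hNr _), one_mul]
      exact Real.rpow_le_rpow hNr.le (by exact_mod_cast hlt.le) (by norm_num)
    rw [ENNReal.ofReal_of_nonpos (by nlinarith)]
    exact zero_le
  obtain ⟨has, hlog, hbig⟩ := hN0 N hge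
  have hn : 8 * (d + d * d) < N * d := by nlinarith
  have hR := regSet_nonempty hd0 hn he
  have hprob := graphMeasure_prob hR
  set z : ℂ := E + η * Complex.I with hz
  have hzim : z.im = η := by simp [hz]
  set j0 : Fin N := ⟨0, by omega⟩ with hj0
  have key : (graphMeasure d N).real
      {ω | |(1 / (N : ℝ)) * ∑ j, imG t z ω j ^ s -
        ∫ ω', imG t z ω' j0 ^ s ∂(graphMeasure d N)| ≤ η}ᶜ ≤ (N : ℝ) ^ (-100 : ℝ) := by
    rcases le_total η 1 with h | h
    · have := large_N hs ht hd0 hNpos hn he hlog has (z := z) (by rw [hzim]; exact hη)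
        (by rw [hzim]; exact h) j0
      rwa [hzim] at this
    · have := big_eta (t := t) hs hNpos hR (z := z) (by rw [hzim]; exact h) j0
      rw [hzim] at this
      exact this.trans hNp.le
  set G : Set ((Fin N → Fin N → Bool) × (Fin N → ℝ)) :=
    {ω | |(1 / (N : ℝ)) * ∑ j, imG t z ω j ^ s -
        ∫ ω', imG t z ω' j0 ^ s ∂(graphMeasure d N)| ≤ η} with hG
  have hsum : 1 ≤ (graphMeasure d N).real G + (graphMeasure d N).real Gᶜ := by
    have := measureReal_union_le (μ := graphMeasure d N) G Gᶜ
    rwa [Set.union_compl_self, probReal_univ] at this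
  have hfin : 1 - ((N0 : ℝ) ^ (100 : ℝ) + 2) * (N : ℝ) ^ (-100 : ℝ) ≤
      (graphMeasure d N).real G := by nlinarith
  exact ENNReal.ofReal_le_of_le_toReal hfin
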